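/- arXiv:1609.03719 — 7 statements merged into one kernel-verified Lean document; each statement's English description precedes it below -/
import Mathlib

section
/- If (X,T) is a minimal topological dynamical system, then for every open set G ⊆ X there is an open set H ⊆ X such that H ⊆ T(G) ⊆ closure(H). In particular, the image under T of a nonempty open set has nonempty interior. -/
open Filter Topology Metric Set

/-- The liminf of the distance between the orbits of `x` and `y` under `T`. -/
noncomputable def orbLiminf {X : Type*} [MetricSpace X] (T : X → X) (x y : X) : ℝ :=
  Filter.atTop.liminf fun n : ℕ => dist (T^[n] x) (T^[n] y)

/-- The limsup of the distance between the orbits of `x` and `y` under `T`. -/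
noncomputable def orbLimsup {X : Type*} [MetricSpace X] (T : X → X) (x y : X) : ℝ :=
  Filter.atTop.limsup fun n : ℕ => dist (T^[n] x) (T^[n] y)

/-- `(x,y)` is an `ε`-Li-Yorke pair: proximal but not `ε`-asymptotic. -/
def LiYorkePairEps {X : Type*} [MetricSpace X] (T : X → X) (ε : ℝ) (x y : X) : Prop :=
  orbLiminf T x y = 0 ∧ orbLimsup T x y > ε

/-- `T` is Li-Yorke sensitive with sensitivity constant `ε`: every point is a limit of
points forming with it an `ε`-Li-Yorke pair. -/
def LYSeps {X : Type*} [MetricSpace X] (T : X → X) (ε : ℝ) : Prop :=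
  ∀ x : X, x ∈ closure {y | LiYorkePairEps T ε x y}

/-- `T` is Li-Yorke sensitive. -/
def LYS {X : Type*} [MetricSpace X] (T : X → X) : Prop :=
  ∃ ε > 0, LYSeps T ε

/-- Topological transitivity. -/
def TopTransitive {X : Type*} [TopologicalSpace X] (T : X → X) : Prop :=
  ∀ U V : Set X, IsOpen U → IsOpen V → U.Nonempty → V.Nonempty →
    ∃ n : ℕ, 0 < n ∧ (U ∩ T^[n] ⁻¹' V).Nonempty

/-- Weak mixing: the product system is transitive. -/
def WeaklyMixing {X : Type*} [TopologicalSpace X] (T : X → X) : Prop :=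
  TopTransitive fun p : X × X => (T p.1, T p.2)

/-- Minimality: every forward orbit is dense. -/
def MinimalSystem {X : Type*} [TopologicalSpace X] (T : X → X) : Prop :=
  ∀ x : X, Dense (Set.range fun n : ℕ => T^[n] x)

/-- `M` is a minimal set for `T`: nonempty, closed, invariant, and every orbit of a point
of `M` is dense in `M`. -/
def IsMinimalSubset {X : Type*} [TopologicalSpace X] (T : X → X) (M : Set X) : Prop :=
  M.Nonempty ∧ IsClosed M ∧ Set.MapsTo T M M ∧
    ∀ x ∈ M, ∀ y ∈ M, y ∈ closure (Set.range fun n : ℕ => T^[n] x)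

/-- A set `D` is `ε`-scrambled for `T`. -/
def ScrambledSet {X : Type*} [MetricSpace X] (T : X → X) (ε : ℝ) (D : Set X) : Prop :=
  ∀ x ∈ D, ∀ y ∈ D, x ≠ y → LiYorkePairEps T ε x y

/-- A minimal map on a compact space is irreducible: no proper closed set is mapped onto the
whole space. -/
theorem MinimalSystem.eq_univ_of_image_eq_univ {X : Type*} [TopologicalSpace X] [CompactSpace X]
    {T : X → X} (hmin : MinimalSystem T) (hTc : Continuous T) {A : Set X} (hA : IsClosed A)
    (hTA : T '' A = univ) : A = univ := by
  rcases isEmpty_or_nonempty X with hX | ⟨⟨x₀⟩⟩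
  · exact Subsingleton.elim _ _
  let K : ℕ → Set X := fun n => ⋂ k ≤ n, T^[k] ⁻¹' A
  have hK_closed : ∀ n, IsClosed (K n) := fun n =>
    isClosed_biInter fun k _ => hA.preimage (hTc.iterate k)
  have hsurj : ∀ x, ∃ z ∈ A, T z = x := fun x => by
    have hx : x ∈ T '' A := hTA ▸ mem_univ x
    exact hx
  have hK_nonempty : ∀ n, (K n).Nonempty := by
    intro n
    induction n with
    | zero =>
      obtain ⟨z, hz, -⟩ := hsurj x₀
      exact ⟨z, by simpa [K] using hz⟩
    | succ n ih =>
      obtain ⟨x, hx⟩ := ih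
      obtain ⟨z, hz, rfl⟩ := hsurj x
      simp only [K, mem_iInter, mem_preimage] at hx
      refine ⟨z, ?_⟩
      simp only [K, mem_iInter, mem_preimage]
      rintro (_ | k) hk
      · exact hz
      · exact hx k (by omega)
  obtain ⟨y, hy⟩ := IsCompact.nonempty_iInter_of_sequence_nonempty_isCompact_isClosed K
    (fun n => biInter_subset_biInter_left fun k (hk : k ≤ n) => Nat.le_succ_of_le hk)
    hK_nonempty (hK_closed 0).isCompact hK_closed
  have horbit : (range fun n : ℕ => T^[n] y) ⊆ A := by
    rintro _ ⟨n, rfl⟩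
    exact mem_iInter₂.1 (mem_iInter.1 hy n) n le_rfl
  exact hA.closure_eq ▸ ((hmin y).mono horbit).closure_eq

/-- Under a minimal map of a compact space, nonempty open sets have images with nonempty
interior. -/
theorem MinimalSystem.interior_image_nonempty {X : Type*} [TopologicalSpace X] [CompactSpace X]
    [T2Space X] {T : X → X} (hmin : MinimalSystem T) (hTc : Continuous T)
    (hTs : Function.Surjective T) {G : Set X} (hG : IsOpen G) (hne : G.Nonempty) :
    (interior (T '' G)).Nonempty := by
  have himage : T '' Gᶜ ≠ univ := fun h =>
    hne.ne_empty (compl_univ_iff.1 (hmin.eq_univ_of_image_eq_univ hTc hG.isClosed_compl h))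
  obtain ⟨x, hx⟩ := nonempty_compl.2 himage
  have hopen : IsOpen (T '' Gᶜ)ᶜ := (hTc.isClosedMap _ hG.isClosed_compl).isOpen_compl
  refine ⟨x, interior_maximal ?_ hopen hx⟩
  intro y hy
  obtain ⟨z, rfl⟩ := hTs y
  exact ⟨z, by_contra fun hz => hy ⟨z, hz, rfl⟩, rfl⟩

/-- If `(X,T)` is minimal then for every open `G ⊆ X` there is an open `H` with
`H ⊆ T(G) ⊆ closure H`; in particular the image of a nonempty open set has
nonempty interior. -/
theorem stmt1 {X : Type*} [MetricSpace X] [CompactSpace X]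
    (T : X → X) (hTc : Continuous T) (hTs : Function.Surjective T)
    (hmin : MinimalSystem T) (G : Set X) (hG : IsOpen G) :
    (∃ H : Set X, IsOpen H ∧ H ⊆ T '' G ∧ T '' G ⊆ closure H) ∧
      (G.Nonempty → (interior (T '' G)).Nonempty) := by
  refine ⟨⟨interior (T '' G), isOpen_interior, interior_subset, ?_⟩,
    hmin.interior_image_nonempty hTc hTs hG⟩
  rintro _ ⟨x, hx, rfl⟩
  refine mem_closure_iff.2 fun V hV hxV => ?_
  obtain ⟨y, hy⟩ := hmin.interior_image_nonempty hTc hTs (hG.inter (hV.preimage hTc)) ⟨x, hx, hxV⟩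
  obtain ⟨z, hz, rfl⟩ := interior_subset hy
  exact ⟨T z, hz.2, interior_mono (image_mono inter_subset_left) hy⟩
end

section
/- If a topological dynamical system (X,T) is Li-Yorke sensitive, then for some δ > 0 the set of δ-asymptotic pairs is a first Baire category subset of X×X. -/
open Filter Topology Metric Set

/-- Pairs whose orbits stay `r`-close from time `N` on. -/
def eventuallyClosePairs {X : Type*} [MetricSpace X] (T : X → X) (r : ℝ) (N : ℕ) : Set (X × X) :=
  {p | ∀ n ≥ N, dist (T^[n] p.1) (T^[n] p.2) ≤ r}

theorem isClosed_eventuallyClosePairs {X : Type*} [MetricSpace X] {T : X → X}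
    (hT : Continuous T) (r : ℝ) (N : ℕ) : IsClosed (eventuallyClosePairs T r N) := by
  simp only [eventuallyClosePairs, ofPred_forall]
  exact isClosed_iInter fun n => isClosed_iInter fun _ => isClosed_le
    (((hT.iterate n).comp continuous_fst).dist ((hT.iterate n).comp continuous_snd))
    continuous_const

theorem orbLimsup_le_of_mem_eventuallyClosePairs {X : Type*} [MetricSpace X] {T : X → X} {r : ℝ}
    {N : ℕ} {x y : X} (h : (x, y) ∈ eventuallyClosePairs T r N) : orbLimsup T x y ≤ r :=
  limsup_le_of_le
    (IsCoboundedUnder.of_frequently_ge (a := 0) (Frequently.of_forall fun _ => dist_nonneg))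
    ((eventually_ge_atTop N).mono h)

theorem exists_mem_eventuallyClosePairs {X : Type*} [MetricSpace X] [CompactSpace X] {T : X → X}
    {r : ℝ} {x y : X} (h : orbLimsup T x y < r) : ∃ N, (x, y) ∈ eventuallyClosePairs T r N := by
  have hb : IsBoundedUnder (· ≤ ·) atTop fun n : ℕ => dist (T^[n] x) (T^[n] y) :=
    isBoundedUnder_of ⟨diam (univ : Set X), fun _ =>
      dist_le_diam_of_mem isCompact_univ.isBounded (mem_univ _) (mem_univ _)⟩
  obtain ⟨N, hN⟩ := eventually_atTop.1 (eventually_lt_of_limsup_lt h hb)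
  exact ⟨N, fun n hn => (hN n hn).le⟩

theorem LYSeps.isNowhereDense_eventuallyClosePairs {X : Type*} [MetricSpace X] {T : X → X}
    (hT : Continuous T) {ε : ℝ} (h : LYSeps T ε) (N : ℕ) :
    IsNowhereDense (eventuallyClosePairs T (ε / 2) N) := by
  rw [(isClosed_eventuallyClosePairs hT _ N).isNowhereDense_iff, eq_empty_iff_forall_notMem]
  rintro ⟨x, y⟩ hxy
  have hslice : ∀ᶠ x' in 𝓝 x, (x', y) ∈ eventuallyClosePairs T (ε / 2) N :=
    (Continuous.prodMk_left y).continuousAt.eventually (mem_interior_iff_mem_nhds.1 hxy)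
  obtain ⟨x', hx', hLY⟩ := mem_closure_iff_nhds.1 (h x) _ hslice
  have hx := interior_subset hxy
  have hclose : (x, x') ∈ eventuallyClosePairs T ε N := fun n hn => by
    have h₁ := hx n hn
    have h₂ := hx' n hn
    dsimp only at h₁ h₂ ⊢
    linarith [dist_triangle_right (T^[n] x) (T^[n] x') (T^[n] y)]
  exact (orbLimsup_le_of_mem_eventuallyClosePairs hclose).not_gt hLY.2

/-- If `(X,T)` is Li-Yorke sensitive then, for some `δ > 0`, the set of `δ`-asymptotic
pairs is a first category subset of `X × X`. -/
theorem stmt5 {X : Type*} [MetricSpace X] [CompactSpace X]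
    (T : X → X) (hTc : Continuous T) (hTs : Function.Surjective T)
    (hlys : LYS T) :
    ∃ δ > (0 : ℝ), IsMeagre {p : X × X | orbLimsup T p.1 p.2 ≤ δ} := by
  obtain ⟨ε, hε, h⟩ := hlys
  refine ⟨ε / 4, by positivity, ?_⟩
  refine (isMeagre_iUnion fun N =>
    (h.isNowhereDense_eventuallyClosePairs hTc N).isMeagre).mono ?_
  rintro ⟨x, y⟩ hxy
  exact mem_iUnion.2 (exists_mem_eventuallyClosePairs (lt_of_le_of_lt hxy (by linarith)))
end

section
/- If (X,T) is a minimal weakly mixing topological dynamical system, then for every x ∈ X the set Tran(x) ⊆ X of points y such that (x,y) is a transitive point of the product system (X×X, T×T) (i.e., the orbit {(T×T)^n(x,y)}_{n≥0} is dense in X×X) is a dense G_δ subset of X. -/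
open Filter Topology Metric Set

/-- In a weakly mixing system, for open nonempty `W`, `V` and every `L`, the times at which some
open set `E` meets some open set `F` are all followed by `L` further times at which `W` meets `V`. -/
theorem WeaklyMixing.exists_hitting_subset {X : Type*} [TopologicalSpace X] {T : X → X}
    (hwm : WeaklyMixing T) (hTc : Continuous T) (hTs : Function.Surjective T) {W V : Set X}
    (hW : IsOpen W) (hV : IsOpen V) (hWne : W.Nonempty) (hVne : V.Nonempty) (L : ℕ) :
    ∃ E F : Set X, IsOpen E ∧ IsOpen F ∧ E.Nonempty ∧ F.Nonempty ∧
      ∀ k, (E ∩ T^[k] ⁻¹' F).Nonempty → ∀ i ≤ L, (W ∩ T^[k + i] ⁻¹' V).Nonempty := by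
  induction L with
  | zero =>
    refine ⟨W, V, hW, hV, hWne, hVne, fun k hk i hi => ?_⟩
    obtain rfl : i = 0 := by omega
    exact hk
  | succ L ih =>
    obtain ⟨E, F, hE, hF, hEne, hFne, h⟩ := ih
    have hV' : IsOpen (T^[L + 1] ⁻¹' V) := hV.preimage (hTc.iterate _)
    have hV'ne : (T^[L + 1] ⁻¹' V).Nonempty := hVne.preimage (hTs.iterate _)
    obtain ⟨n, -, ⟨a, b⟩, ⟨haE, hbF⟩, hn⟩ :=
      hwm (E ×ˢ F) (W ×ˢ (T^[L + 1] ⁻¹' V)) (hE.prod hF) (hW.prod hV')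
        (hEne.prod hFne) (hWne.prod hV'ne)
    change (Prod.map T T)^[n] (a, b) ∈ W ×ˢ (T^[L + 1] ⁻¹' V) at hn
    rw [Prod.map_iterate] at hn
    obtain ⟨haW, hbV⟩ := hn
    refine ⟨E ∩ T^[n] ⁻¹' W, F ∩ T^[n] ⁻¹' (T^[L + 1] ⁻¹' V),
      hE.inter (hW.preimage (hTc.iterate _)), hF.inter (hV'.preimage (hTc.iterate _)),
      ⟨a, haE, haW⟩, ⟨b, hbF, hbV⟩, ?_⟩
    rintro k ⟨z, ⟨hzE, hzW⟩, hzF, hzV⟩ i hi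
    rcases hi.lt_or_eq with hi | rfl
    · exact h k ⟨z, hzE, hzF⟩ i (by omega)
    · refine ⟨T^[n] z, hzW, ?_⟩
      simp only [mem_preimage, ← Function.iterate_add_apply] at hzV ⊢
      rwa [show k + (L + 1) + n = L + 1 + (n + k) by omega]

/-- In a weakly mixing system, the set of times at which `W` meets `V` is thick. -/
theorem WeaklyMixing.exists_forall_le_hitting {X : Type*} [TopologicalSpace X] {T : X → X}
    (hwm : WeaklyMixing T) (hTc : Continuous T) (hTs : Function.Surjective T) {W V : Set X}
    (hW : IsOpen W) (hV : IsOpen V) (hWne : W.Nonempty) (hVne : V.Nonempty) (L : ℕ) :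
    ∃ m, ∀ i ≤ L, (W ∩ T^[m + i] ⁻¹' V).Nonempty := by
  obtain ⟨E, F, hE, hF, hEne, hFne, h⟩ := hwm.exists_hitting_subset hTc hTs hW hV hWne hVne L
  obtain ⟨k, -, ⟨a, b⟩, hab, hk⟩ :=
    hwm (E ×ˢ E) (F ×ˢ F) (hE.prod hE) (hF.prod hF) (hEne.prod hEne) (hFne.prod hFne)
  change (Prod.map T T)^[k] (a, b) ∈ F ×ˢ F at hk
  rw [Prod.map_iterate] at hk
  exact ⟨k, h k ⟨a, hab.1, hk.1⟩⟩

/-- In a compact minimal system, all points visit a given nonempty open set within a uniformly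
bounded time. -/
theorem MinimalSystem.exists_uniform_return {X : Type*} [TopologicalSpace X] [CompactSpace X]
    {T : X → X} (hmin : MinimalSystem T) (hTc : Continuous T) {U : Set X} (hU : IsOpen U)
    (hUne : U.Nonempty) : ∃ L : ℕ, ∀ z, ∃ i ≤ L, T^[i] z ∈ U := by
  obtain ⟨t, ht⟩ := isCompact_univ.elim_finite_subcover (fun i : ℕ => T^[i] ⁻¹' U)
    (fun i => hU.preimage (hTc.iterate i)) (fun z _ => by
      obtain ⟨_, hy, i, rfl⟩ := (hmin z).inter_open_nonempty U hU hUne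
      exact mem_iUnion.2 ⟨i, hy⟩)
  refine ⟨t.sup id, fun z => ?_⟩
  obtain ⟨i, hi, hz⟩ := mem_iUnion₂.1 (ht (mem_univ z))
  exact ⟨i, Finset.le_sup (f := id) hi, hz⟩

/-- In a compact minimal weakly mixing system, the visits of a point `x` to `U` occur
at some time at which `W` meets `V`. -/
theorem MinimalSystem.exists_iterate_mem_hitting {X : Type*} [TopologicalSpace X]
    [CompactSpace X] {T : X → X} (hmin : MinimalSystem T) (hwm : WeaklyMixing T)
    (hTc : Continuous T) (hTs : Function.Surjective T) (x : X) {U V W : Set X}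
    (hU : IsOpen U) (hV : IsOpen V) (hW : IsOpen W)
    (hUne : U.Nonempty) (hVne : V.Nonempty) (hWne : W.Nonempty) :
    ∃ n : ℕ, T^[n] x ∈ U ∧ (W ∩ T^[n] ⁻¹' V).Nonempty := by
  obtain ⟨L, hL⟩ := hmin.exists_uniform_return hTc hU hUne
  obtain ⟨m, hm⟩ := hwm.exists_forall_le_hitting hTc hTs hW hV hWne hVne L
  obtain ⟨i, hi, hx⟩ := hL (T^[m] x)
  refine ⟨m + i, ?_, hm i hi⟩
  rwa [add_comm, Function.iterate_add_apply]

/-- If `(X,T)` is minimal weakly mixing then for every `x ∈ X` the set `Tran(x)` of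
points `y` such that `(x,y)` is a transitive point of `(X × X, T × T)` is a dense `G_δ`
subset of `X`. -/
theorem stmt8 {X : Type*} [MetricSpace X] [CompactSpace X]
    (T : X → X) (hTc : Continuous T) (hTs : Function.Surjective T)
    (hmin : MinimalSystem T) (hwm : WeaklyMixing T) (x : X) :
    IsGδ {y : X |
        Dense (Set.range fun n : ℕ => (fun p : X × X => (T p.1, T p.2))^[n] (x, y))} ∧
      Dense {y : X |
        Dense (Set.range fun n : ℕ => (fun p : X × X => (T p.1, T p.2))^[n] (x, y))} := by
  let A : Set (X × X) → Set X := fun s => ⋃ n : ℕ, {y | (T^[n] x, T^[n] y) ∈ s}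
  let B := TopologicalSpace.countableBasis (X × X)
  have hB : TopologicalSpace.IsTopologicalBasis B :=
    TopologicalSpace.isBasis_countableBasis (X × X)
  have hBc : B.Countable := TopologicalSpace.countable_countableBasis (X × X)
  have hAo : ∀ s ∈ B, IsOpen (A s) := fun s hs => isOpen_iUnion fun n =>
    (hB.isOpen hs).preimage (continuous_const.prodMk (hTc.iterate n))
  have hAd : ∀ s ∈ B, Dense (A s) := by
    intro s hs
    obtain ⟨⟨a, b⟩, hab⟩ := TopologicalSpace.nonempty_of_mem_countableBasis hs
    obtain ⟨U, V, hU, hV, haU, hbV, hUV⟩ := isOpen_prod_iff.1 (hB.isOpen hs) a b hab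
    refine dense_iff_inter_open.2 fun W hW hWne => ?_
    obtain ⟨n, hx, y, hyW, hyV⟩ :=
      hmin.exists_iterate_mem_hitting hwm hTc hTs x hU hV hW ⟨a, haU⟩ ⟨b, hbV⟩ hWne
    exact ⟨y, hyW, mem_iUnion.2 ⟨n, hUV ⟨hx, hyV⟩⟩⟩
  have hset : {y : X | Dense (Set.range fun n : ℕ =>
      (fun p : X × X => (T p.1, T p.2))^[n] (x, y))} = ⋂ s ∈ B, A s := by
    ext y
    have hiter : ∀ n : ℕ,
        (fun p : X × X => (T p.1, T p.2))^[n] (x, y) = (T^[n] x, T^[n] y) := fun n => by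
      change (Prod.map T T)^[n] (x, y) = _
      rw [Prod.map_iterate, Prod.map_apply]
    simp only [hiter, mem_ofPred_eq, mem_iInter, hB.dense_iff, A, mem_iUnion]
    refine forall₂_congr fun s hs => ?_
    constructor
    · intro h
      obtain ⟨_, hps, n, rfl⟩ := h (TopologicalSpace.nonempty_of_mem_countableBasis hs)
      exact ⟨n, hps⟩
    · rintro ⟨n, hn⟩ -
      exact ⟨_, hn, n, rfl⟩
  rw [hset]
  exact ⟨IsGδ.biInter hBc fun s hs => (hAo s hs).isGδ, dense_biInter_of_isOpen hAo hBc hAd⟩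
end

section
/- Let (X,T) be a minimal weakly mixing topological dynamical system, let A be a finite space with the discrete topology, let Y = X×A be equipped with the max-metric, and let (Y,S) be a skew-product extension of (X,T) with S(t,a) = (T(t), G_t(a)), where every fibre map G_t is a bijection of A. Then (Y,S) is LYS_ε for every ε with 0 < ε < diam(X). -/
open Filter Topology Metric Set

open scoped Pointwise

/-! ### Hitting times and the filter they generate -/

/-- The set of times at which some point of `U` visits `V`. -/
def hitTimes {X : Type*} (T : X → X) (U V : Set X) : Set ℕ :=
  {n | ∃ t ∈ U, T^[n] t ∈ V}

/-- A proper, forward shift-invariant filter on `ℕ` that contains all sets of hitting times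
between nonempty open sets. -/
structure IsMixingFilter {X : Type*} [TopologicalSpace X] (T : X → X) (F : Filter ℕ) : Prop where
  neBot : F.NeBot
  hitTimes_mem : ∀ U V : Set X, IsOpen U → IsOpen V → U.Nonempty → V.Nonempty →
    hitTimes T U V ∈ F
  tendsto_add : ∀ j : ℕ, Tendsto (fun n => n + j) F F

theorem iterate_prodMap_apply {X : Type*} (T : X → X) (n : ℕ) (p : X × X) :
    (fun p : X × X => (T p.1, T p.2))^[n] p = (T^[n] p.1, T^[n] p.2) := by
  induction n generalizing p with
  | zero => rfl
  | succ n ih => simp [Function.iterate_succ_apply, ih]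

theorem WeaklyMixing.hitTimes_inter_nonempty {X : Type*} [TopologicalSpace X] {T : X → X}
    (hwm : WeaklyMixing T) {U V U' V' : Set X} (hU : IsOpen U) (hV : IsOpen V) (hU' : IsOpen U')
    (hV' : IsOpen V') (nU : U.Nonempty) (nV : V.Nonempty) (nU' : U'.Nonempty)
    (nV' : V'.Nonempty) : (hitTimes T U V ∩ hitTimes T U' V').Nonempty := by
  obtain ⟨n, -, p, hp, hp'⟩ := hwm (U ×ˢ U') (V ×ˢ V') (hU.prod hU') (hV.prod hV')
    (nU.prod nU') (nV.prod nV')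
  rw [mem_preimage, iterate_prodMap_apply] at hp'
  exact ⟨n, ⟨p.1, hp.1, hp'.1⟩, ⟨p.2, hp.2, hp'.2⟩⟩

/-- Furstenberg's intersection lemma: for a weakly mixing map the sets of hitting times form a
filter base. -/
theorem WeaklyMixing.exists_hitTimes_subset_inter {X : Type*} [TopologicalSpace X] {T : X → X}
    (hT : Continuous T) (hwm : WeaklyMixing T) {U V U' V' : Set X} (hU : IsOpen U)
    (hV : IsOpen V) (hU' : IsOpen U') (hV' : IsOpen V') (nU : U.Nonempty) (nV : V.Nonempty)
    (nU' : U'.Nonempty) (nV' : V'.Nonempty) :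
    ∃ U₁ V₁ : Set X, IsOpen U₁ ∧ IsOpen V₁ ∧ U₁.Nonempty ∧ V₁.Nonempty ∧
      hitTimes T U₁ V₁ ⊆ hitTimes T U V ∩ hitTimes T U' V' := by
  obtain ⟨m, ⟨t, ht, ht'⟩, ⟨s, hs, hs'⟩⟩ :=
    hwm.hitTimes_inter_nonempty hU hU' hV hV' nU nU' nV nV'
  refine ⟨U ∩ T^[m] ⁻¹' U', V ∩ T^[m] ⁻¹' V', hU.inter (hU'.preimage (hT.iterate m)),
    hV.inter (hV'.preimage (hT.iterate m)), ⟨t, ht, ht'⟩, ⟨s, hs, hs'⟩, ?_⟩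
  rintro n ⟨r, ⟨hr, hr'⟩, hn, hn'⟩
  refine ⟨⟨r, hr, hn⟩, ⟨T^[m] r, hr', ?_⟩⟩
  rw [mem_preimage, ← Function.iterate_add_apply] at hn'
  rwa [← Function.iterate_add_apply, add_comm]

theorem WeaklyMixing.exists_isMixingFilter {X : Type*} [TopologicalSpace X] [Nonempty X]
    {T : X → X} (hT : Continuous T) (hTs : Function.Surjective T) (hwm : WeaklyMixing T) :
    ∃ F : Filter ℕ, IsMixingFilter T F := by
  let F : Filter ℕ :=
    { sets := {D | ∃ U V : Set X, IsOpen U ∧ IsOpen V ∧ U.Nonempty ∧ V.Nonempty ∧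
        hitTimes T U V ⊆ D}
      univ_sets := ⟨univ, univ, isOpen_univ, isOpen_univ, univ_nonempty, univ_nonempty,
        subset_univ _⟩
      sets_of_superset := by
        rintro D E ⟨U, V, hU, hV, nU, nV, h⟩ hDE
        exact ⟨U, V, hU, hV, nU, nV, h.trans hDE⟩
      inter_sets := by
        rintro D E ⟨U, V, hU, hV, nU, nV, h⟩ ⟨U', V', hU', hV', nU', nV', h'⟩
        obtain ⟨U₁, V₁, hU₁, hV₁, nU₁, nV₁, h₁⟩ :=
          hwm.exists_hitTimes_subset_inter hT hU hV hU' hV' nU nV nU' nV'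
        exact ⟨U₁, V₁, hU₁, hV₁, nU₁, nV₁, h₁.trans (inter_subset_inter h h')⟩ }
  refine ⟨F, ?_, ?_, ?_⟩
  · refine Filter.neBot_iff.2 fun hbot => ?_
    have h : (∅ : Set ℕ) ∈ F := hbot ▸ Filter.mem_bot
    obtain ⟨U, V, hU, hV, nU, nV, h⟩ := h
    obtain ⟨n, hn, -⟩ := hwm.hitTimes_inter_nonempty hU hV hU hV nU nV nU nV
    exact h hn
  · exact fun U V hU hV nU nV => ⟨U, V, hU, hV, nU, nV, Subset.rfl⟩
  · rintro j D ⟨U, V, hU, hV, nU, nV, h⟩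
    refine ⟨U, T^[j] ⁻¹' V, hU, hV.preimage (hT.iterate j), nU, nV.preimage (hTs.iterate j), ?_⟩
    rintro n ⟨t, ht, ht'⟩
    refine h ⟨t, ht, ?_⟩
    rwa [mem_preimage, ← Function.iterate_add_apply, add_comm] at ht'

/-- Members of a mixing filter contain arbitrarily long intervals. -/
theorem IsMixingFilter.exists_forall_add_mem {X : Type*} [TopologicalSpace X] {T : X → X}
    {F : Filter ℕ} (hF : IsMixingFilter T F) {D : Set ℕ} (hD : D ∈ F) (M : ℕ) :
    ∃ n, ∀ i ≤ M, n + i ∈ D := by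
  have := hF.neBot
  have h : ∀ᶠ n in F, ∀ i ∈ Set.Iic M, n + i ∈ D :=
    (Filter.eventually_all_finite (Set.finite_Iic M)).2 fun i _ => hF.tendsto_add i hD
  exact h.exists

/-- Visits of a point to an open set that is reached from everywhere in a compact invariant set
occur at times belonging to any given member of a mixing filter. -/
theorem IsMixingFilter.exists_visit {X Z : Type*} [TopologicalSpace X] [TopologicalSpace Z]
    {T : X → X} {F : Filter ℕ} (hF : IsMixingFilter T F) {f : Z → Z} (hf : Continuous f)
    {C O : Set Z} (hC : IsCompact C) (hfC : MapsTo f C C) (hO : IsOpen O)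
    (hCO : ∀ w ∈ C, ∃ i, f^[i] w ∈ O) {z : Z} (hz : z ∈ C) {k : ℕ} (hk : 0 < k)
    {D : Set ℕ} (hD : D ∈ F) (N : ℕ) : ∃ n ≥ N, k * n ∈ D ∧ f^[n] z ∈ O := by
  obtain ⟨J, hJ⟩ := hC.elim_finite_subcover (fun i => f^[i] ⁻¹' O)
    (fun i => hO.preimage (hf.iterate i)) fun w hw => mem_iUnion.2 (hCO w hw)
  obtain ⟨n, hn⟩ := hF.exists_forall_add_mem hD (k * (J.sup id + N + 1))
  have hmem : f^[n / k + 1 + N] z ∈ C := hfC.iterate _ hz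
  obtain ⟨i, hi, hiO⟩ := mem_iUnion₂.1 (hJ hmem)
  have hiM : i ≤ J.sup id := Finset.le_sup (f := id) hi
  refine ⟨i + (n / k + 1 + N), (Nat.le_add_left N _).trans (Nat.le_add_left _ i), ?_, ?_⟩
  · have h₁ := Nat.div_add_mod n k
    have h₂ := Nat.mod_lt n hk
    have h₃ : k * (i + (n / k + 1 + N)) = n + (k * (i + N) + (k - n % k)) := by
      zify [h₂.le]
      have : (n : ℤ) = k * (n / k : ℕ) + (n % k : ℕ) := by exact_mod_cast h₁.symm
      push_cast at this ⊢
      linear_combination -this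
    rw [h₃]
    refine hn _ ?_
    have : k * (i + N) ≤ k * (J.sup id + N) := by gcongr
    rw [mul_add k _ 1]
    omega
  · rwa [Function.iterate_add_apply]

/-! ### Orbit closures -/

/-- The closure of the forward orbit of `z`. -/
def orbitClosure {Z : Type*} [TopologicalSpace Z] (f : Z → Z) (z : Z) : Set Z :=
  closure (range fun n : ℕ => f^[n] z)

section OrbitClosure

variable {Z : Type*} [TopologicalSpace Z] {f : Z → Z}

theorem isClosed_orbitClosure (f : Z → Z) (z : Z) : IsClosed (orbitClosure f z) :=
  isClosed_closure

theorem mem_orbitClosure_self (f : Z → Z) (z : Z) : z ∈ orbitClosure f z :=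
  subset_closure ⟨0, rfl⟩

theorem mapsTo_orbitClosure (hf : Continuous f) (z : Z) :
    MapsTo f (orbitClosure f z) (orbitClosure f z) := by
  refine MapsTo.closure ?_ hf
  rintro _ ⟨n, rfl⟩
  exact ⟨n + 1, Function.iterate_succ_apply' f n z⟩

theorem orbitClosure_subset {C : Set Z} (hC : IsClosed C) (hfC : MapsTo f C C) {z : Z}
    (hz : z ∈ C) : orbitClosure f z ⊆ C := by
  refine closure_minimal ?_ hC
  rintro _ ⟨n, rfl⟩
  exact hfC.iterate n hz

theorem orbitClosure_subset_of_mem (hf : Continuous f) {z w : Z} (hw : w ∈ orbitClosure f z) :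
    orbitClosure f w ⊆ orbitClosure f z :=
  orbitClosure_subset (isClosed_orbitClosure f z) (mapsTo_orbitClosure hf z) hw

theorem orbitClosure_iterate_subset (hf : Continuous f) (k : ℕ) (z : Z) :
    orbitClosure f^[k] z ⊆ orbitClosure f z :=
  orbitClosure_subset (isClosed_orbitClosure f z) ((mapsTo_orbitClosure hf z).iterate k)
    (mem_orbitClosure_self f z)

theorem exists_iterate_mem_of_mem_orbitClosure {z w : Z} (hw : w ∈ orbitClosure f z) {O : Set Z}
    (hO : IsOpen O) (hwO : w ∈ O) : ∃ n, f^[n] z ∈ O := by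
  obtain ⟨_, hO', n, rfl⟩ := mem_closure_iff.1 hw O hO hwO
  exact ⟨n, hO'⟩

end OrbitClosure

/-- Iterates of a minimal map that admits a mixing filter are minimal. -/
theorem MinimalSystem.iterate {X : Type*} [TopologicalSpace X] [BaireSpace X]
    {T : X → X} (hT : Continuous T) (hTs : Function.Surjective T) (hmin : MinimalSystem T)
    {F : Filter ℕ} (hF : IsMixingFilter T F) {k : ℕ} (hk : 0 < k) : MinimalSystem T^[k] := by
  intro x
  have : Nonempty X := ⟨x⟩
  let O : Fin k → Set X := fun i => orbitClosure T^[k] (T^[i] x)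
  have hO : ⋃ i, O i = univ := by
    have hcl : IsClosed (⋃ i, O i) :=
      isClosed_iUnion_of_finite fun i => isClosed_orbitClosure _ _
    refine eq_univ_of_univ_subset ((hmin x).closure_eq ▸ closure_minimal ?_ hcl)
    rintro _ ⟨n, rfl⟩
    refine mem_iUnion.2 ⟨⟨n % k, Nat.mod_lt n hk⟩, subset_closure ⟨n / k, ?_⟩⟩
    simp only
    rw [← Function.iterate_mul, ← Function.iterate_add_apply, Nat.div_add_mod]
  obtain ⟨i, hi⟩ := nonempty_interior_of_iUnion_of_closed
    (fun i : Fin k => isClosed_orbitClosure T^[k] (T^[i] x)) hO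
  have hdense : Dense (range fun n : ℕ => (T^[k])^[n] (T^[i] x)) := by
    rw [← dense_closure, dense_iff_inter_open]
    intro U hU nU
    have hD := hF.hitTimes_mem _ U isOpen_interior hU hi nU
    obtain ⟨n, -, ⟨t, ht, htU⟩, -⟩ := hF.exists_visit (Z := X) continuous_id
      (isCompact_singleton (x := x)) (by simp [MapsTo]) isOpen_univ (fun _ _ => ⟨0, trivial⟩)
      (mem_singleton x) hk hD 0
    refine ⟨_, htU, ?_⟩
    rw [Function.iterate_mul]
    exact (mapsTo_orbitClosure (hT.iterate k) _).iterate n (interior_subset ht)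
  refine ((hTs.iterate (k - i)).denseRange.comp hdense (hT.iterate (k - i))).mono ?_
  rintro _ ⟨n, rfl⟩
  refine ⟨n + 1, ?_⟩
  simp only [Function.comp_apply, ← Function.iterate_mul, ← Function.iterate_add_apply]
  congr 2
  have := i.2
  rw [mul_add, mul_one]
  omega

/-! ### Skew products with a finite group -/

/-- The skew product over `T` defined by the group-valued function `φ`. -/
def skewMap {X K : Type*} [Group K] (T : X → X) (φ : X → K) (z : X × K) : X × K :=
  (T z.1, φ z.1 * z.2)

/-- The cocycle over `T` generated by `φ`. -/
def cocycle {X K : Type*} [Group K] (T : X → X) (φ : X → K) : ℕ → X → K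
  | 0, _ => 1
  | n + 1, t => cocycle T φ n (T t) * φ t

section Cocycle

variable {X K : Type*} [Group K] (T : X → X) (φ : X → K)

theorem skewMap_iterate_apply (n : ℕ) (z : X × K) :
    (skewMap T φ)^[n] z = (T^[n] z.1, cocycle T φ n z.1 * z.2) := by
  induction n generalizing z with
  | zero => simp [cocycle]
  | succ n ih => simp [Function.iterate_succ_apply, ih, cocycle, skewMap, mul_assoc]

theorem skewMap_iterate (k : ℕ) : (skewMap T φ)^[k] = skewMap T^[k] (cocycle T φ k) :=
  funext fun z => skewMap_iterate_apply T φ k z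

theorem cocycle_add (m n : ℕ) (t : X) :
    cocycle T φ (m + n) t = cocycle T φ m (T^[n] t) * cocycle T φ n t := by
  induction n generalizing t with
  | zero => simp [cocycle]
  | succ n ih => simp [cocycle, ih, mul_assoc]

variable [TopologicalSpace X] [TopologicalSpace K] {T φ}

theorem exists_mem_orbitClosure_skewMap [Finite K] [CompactSpace X] [T2Space X] (hmin : MinimalSystem T)
    (z : X × K) (y : X) : ∃ g, (y, g) ∈ orbitClosure (skewMap T φ) z := by
  have hcl : IsClosed (Prod.fst '' orbitClosure (skewMap T φ) z) :=
    ((isClosed_orbitClosure _ z).isCompact.image continuous_fst).isClosed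
  have hsub : (range fun n : ℕ => T^[n] z.1) ⊆ Prod.fst '' orbitClosure (skewMap T φ) z := by
    rintro _ ⟨n, rfl⟩
    exact ⟨_, subset_closure ⟨n, rfl⟩, by simp [skewMap_iterate_apply]⟩
  have hy : y ∈ Prod.fst '' orbitClosure (skewMap T φ) z :=
    closure_minimal hsub hcl (hmin z.1 y)
  obtain ⟨w, hw, rfl⟩ := hy
  exact ⟨w.2, hw⟩

variable [DiscreteTopology K]

theorem continuous_cocycle (hT : Continuous T) (hφ : Continuous φ) (n : ℕ) :
    Continuous (cocycle T φ n) := by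
  induction n with
  | zero => exact continuous_const
  | succ n ih => exact (ih.comp hT).mul hφ

theorem continuous_skewMap (hT : Continuous T) (hφ : Continuous φ) :
    Continuous (skewMap T φ) :=
  (hT.comp continuous_fst).prodMk ((hφ.comp continuous_fst).mul continuous_snd)

theorem mul_right_mem_orbitClosure_skewMap {z w : X × K}
    (hw : w ∈ orbitClosure (skewMap T φ) z) (g : K) :
    (w.1, w.2 * g) ∈ orbitClosure (skewMap T φ) (z.1, z.2 * g) := by
  have hc : Continuous fun w : X × K => (w.1, w.2 * g) :=
    continuous_fst.prodMk (continuous_snd.mul continuous_const)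
  refine map_mem_closure (f := fun w : X × K => (w.1, w.2 * g)) hc hw ?_
  rintro _ ⟨n, rfl⟩
  exact ⟨n, by simp [skewMap_iterate_apply, mul_assoc]⟩

variable [Finite K]

theorem one_mem_orbitClosure_skewMap (hT : Continuous T) (hφ : Continuous φ) {x : X} {g : K}
    (hg : (x, g) ∈ orbitClosure (skewMap T φ) (x, 1)) :
    (x, 1) ∈ orbitClosure (skewMap T φ) (x, g) := by
  have hpow : ∀ n : ℕ, (x, g ^ (n + 1)) ∈ orbitClosure (skewMap T φ) (x, g) := by
    intro n
    induction n with
    | zero => simpa using mem_orbitClosure_self _ _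
    | succ n ih =>
      refine orbitClosure_subset_of_mem (continuous_skewMap hT hφ) ih ?_
      simpa [pow_succ'] using mul_right_mem_orbitClosure_skewMap hg (g ^ (n + 1))
  have h := hpow (orderOf g - 1)
  rwa [Nat.sub_add_cancel (orderOf_pos g), pow_orderOf_eq_one] at h

theorem orbitClosure_skewMap_symm [CompactSpace X] [T2Space X] (hT : Continuous T)
    (hφ : Continuous φ) (hmin : MinimalSystem T) {z w : X × K}
    (hw : w ∈ orbitClosure (skewMap T φ) z) : z ∈ orbitClosure (skewMap T φ) w := by
  obtain ⟨x, h⟩ := z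
  have hc := continuous_skewMap hT hφ
  obtain ⟨g, hg⟩ := exists_mem_orbitClosure_skewMap (φ := φ) hmin w x
  have h₁ := mul_right_mem_orbitClosure_skewMap (orbitClosure_subset_of_mem hc hw hg) h⁻¹
  simp only [mul_inv_cancel] at h₁
  have h₂ := mul_right_mem_orbitClosure_skewMap (one_mem_orbitClosure_skewMap hT hφ h₁) h
  simp only [one_mul, inv_mul_cancel_right] at h₂
  exact orbitClosure_subset_of_mem hc hg h₂

theorem isOpen_orbitClosure_skewMap [CompactSpace X] [T2Space X] (hT : Continuous T)
    (hφ : Continuous φ) (hmin : MinimalSystem T) (z : X × K) :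
    IsOpen (orbitClosure (skewMap T φ) z) := by
  have hc := continuous_skewMap hT hφ
  have heq : (orbitClosure (skewMap T φ) z)ᶜ =
      ⋃ g ∈ {g : K | (z.1, g) ∉ orbitClosure (skewMap T φ) z},
        orbitClosure (skewMap T φ) (z.1, g) := by
    ext w
    simp only [mem_compl_iff, mem_iUnion, mem_ofPred_eq, exists_prop]
    constructor
    · intro hw
      obtain ⟨g, hg⟩ := exists_mem_orbitClosure_skewMap (φ := φ) hmin w z.1
      have hwg := orbitClosure_skewMap_symm hT hφ hmin hg
      exact ⟨g, fun h => hw (orbitClosure_subset_of_mem hc h hwg), hwg⟩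
    · rintro ⟨g, hg, hwg⟩ hw
      exact hg (orbitClosure_subset_of_mem hc hw (orbitClosure_skewMap_symm hT hφ hmin hwg))
  rw [← isClosed_compl_iff, heq]
  exact (Set.toFinite _).isClosed_biUnion fun g _ => isClosed_orbitClosure _ _

/-- The orbit closures of a point under the iterates of a finite group extension of a minimal
mixing map stabilise. -/
theorem exists_orbitClosure_iterate_stable [CompactSpace X] [T2Space X] (hT : Continuous T)
    (hφ : Continuous φ) (hmin : ∀ k, 0 < k → MinimalSystem T^[k]) (x : X) :
    ∃ k, 0 < k ∧ ∀ j, 0 < j → orbitClosure (skewMap T φ)^[k * j] (x, (1 : K)) =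
      orbitClosure (skewMap T φ)^[k] (x, 1) := by
  let L : ℕ → Set K := fun k => {g | (x, g) ∈ orbitClosure (skewMap T φ)^[k] (x, 1)}
  have hc := continuous_skewMap hT hφ
  obtain ⟨k, hk, hkmin⟩ : ∃ k, 0 < k ∧ ∀ l, 0 < l → (L k).ncard ≤ (L l).ncard := by
    have hne : (Ioi (0 : ℕ)).Nonempty := ⟨1, mem_Ioi.2 one_pos⟩
    exact ⟨Function.argminOn (fun k => (L k).ncard) (Ioi 0) hne,
      Function.argminOn_mem _ _ hne, fun l hl =>
        Function.argminOn_le (fun k => (L k).ncard) (Ioi 0) (mem_Ioi.2 hl)⟩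
  refine ⟨k, hk, fun j hj => ?_⟩
  have hsub : ∀ z, orbitClosure (skewMap T φ)^[k * j] z ⊆ orbitClosure (skewMap T φ)^[k] z :=
    fun z => by
      rw [Function.iterate_mul]
      exact orbitClosure_iterate_subset (hc.iterate k) j z
  have hL : L (k * j) = L k :=
    Set.eq_of_subset_of_ncard_le (fun g hg => hsub _ hg) (hkmin _ (Nat.mul_pos hk hj))
  refine Subset.antisymm (hsub _) fun w hw => ?_
  have hkj := Nat.mul_pos hk hj
  obtain ⟨g, hg⟩ := exists_mem_orbitClosure_skewMap (φ := cocycle T φ (k * j)) (hmin _ hkj) w x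
  have hwg := orbitClosure_skewMap_symm (hT.iterate _) (continuous_cocycle hT hφ _)
    (hmin _ hkj) hg
  rw [← skewMap_iterate] at hg hwg
  have hgL : g ∈ L (k * j) := by
    rw [hL]
    exact orbitClosure_subset_of_mem (hc.iterate k) hw (hsub _ hg)
  exact orbitClosure_subset_of_mem (hc.iterate _) hgL hwg

end Cocycle

/-! ### Return values of the cocycle -/

/-- The set of times at which some point of `U` visits `V` with cocycle value `g`. -/
def hitTimesWith {X K : Type*} [Group K] (T : X → X) (φ : X → K) (g : K) (U V : Set X) : Set ℕ :=
  {n | ∃ t ∈ U, T^[n] t ∈ V ∧ cocycle T φ n t = g}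

/-- The cocycle values with which `U` visits `V` frequently along the filter `R`. -/
def frequentValues {X K : Type*} [Group K] (T : X → X) (φ : X → K) (R : Filter ℕ)
    (U V : Set X) : Set K :=
  {g | ∃ᶠ n in R, n ∈ hitTimesWith T φ g U V}

/-- The set of frequent values is the same for all nonempty open subsets of `U` and `V`. -/
def HomogeneousValues {X K : Type*} [TopologicalSpace X] [Group K] (T : X → X) (φ : X → K)
    (R : Filter ℕ) (U V : Set X) : Prop :=
  ∀ U' V' : Set X, IsOpen U' → IsOpen V' → U'.Nonempty → V'.Nonempty → U' ⊆ U → V' ⊆ V →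
    frequentValues T φ R U' V' = frequentValues T φ R U V

/-- The left translates of `I` by the values of the returns to `V` at time `s`. -/
def returnTranslate {X K : Type*} [Group K] (T : X → X) (φ : X → K) (V : Set X) (I : Set K)
    (s : ℕ) : Set K :=
  {g | s ∈ hitTimesWith T φ g V V} * I

section ReturnValues

variable {X K : Type*} [Group K] {T : X → X} {φ : X → K}

theorem frequentValues_mono {R : Filter ℕ} {U V U' V' : Set X} (hU : U' ⊆ U) (hV : V' ⊆ V) :
    frequentValues T φ R U' V' ⊆ frequentValues T φ R U V := fun _ hg =>
  hg.mono fun _ ⟨t, ht, htV, htg⟩ => ⟨t, hU ht, hV htV, htg⟩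

theorem exists_mem_hitTimesWith {U V : Set X} {n : ℕ} (hn : n ∈ hitTimes T U V) :
    ∃ g, n ∈ hitTimesWith T φ g U V :=
  let ⟨t, ht, htV⟩ := hn
  ⟨_, t, ht, htV, rfl⟩

variable [TopologicalSpace X]

theorem exists_homogeneousValues [Finite K] (R : Filter ℕ) {U V : Set X} (hU : IsOpen U) (hV : IsOpen V)
    (nU : U.Nonempty) (nV : V.Nonempty) :
    ∃ U₁ V₁ : Set X, IsOpen U₁ ∧ IsOpen V₁ ∧ U₁.Nonempty ∧ V₁.Nonempty ∧ U₁ ⊆ U ∧ V₁ ⊆ V ∧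
      HomogeneousValues T φ R U₁ V₁ := by
  let B : Set (Set X × Set X) :=
    {p | IsOpen p.1 ∧ IsOpen p.2 ∧ p.1.Nonempty ∧ p.2.Nonempty ∧ p.1 ⊆ U ∧ p.2 ⊆ V}
  let c : Set X × Set X → ℕ := fun p => (frequentValues T φ R p.1 p.2).ncard
  have hne : B.Nonempty := ⟨(U, V), hU, hV, nU, nV, Subset.rfl, Subset.rfl⟩
  obtain ⟨h₁, h₂, h₃, h₄, h₅, h₆⟩ := Function.argminOn_mem c B hne
  refine ⟨_, _, h₁, h₂, h₃, h₄, h₅, h₆, fun U' V' hU' hV' nU' nV' hUs hVs => ?_⟩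
  exact Set.eq_of_subset_of_ncard_le (frequentValues_mono hUs hVs)
    (Function.argminOn_le c B (a := (U', V')) ⟨hU', hV', nU', nV', hUs.trans h₅, hVs.trans h₆⟩)

variable [TopologicalSpace K] [DiscreteTopology K]

theorem isOpen_setOf_iterate_mem_cocycle_eq (hT : Continuous T) (hφ : Continuous φ)
    {U V : Set X} (hU : IsOpen U) (hV : IsOpen V) (n : ℕ) (g : K) :
    IsOpen {t | t ∈ U ∧ T^[n] t ∈ V ∧ cocycle T φ n t = g} :=
  hU.inter ((hV.preimage (hT.iterate n)).inter
    ((isOpen_discrete {g}).preimage (continuous_cocycle hT hφ n)))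

variable [Finite K]

variable {R : Filter ℕ} {U V : Set X}

theorem HomogeneousValues.singleton_mul_eq (hT : Continuous T) (hφ : Continuous φ)
    (hU : IsOpen U) (hV : IsOpen V) (hI : HomogeneousValues T φ R U V) {j : ℕ} {g h : K}
    (hg : j ∈ hitTimesWith T φ g V V) (hh : j ∈ hitTimesWith T φ h U U) :
    {g} * frequentValues T φ R U V = frequentValues T φ R U V * {h} := by
  set I := frequentValues T φ R U V with hIdef
  have hsub : (fun a => g * a * h⁻¹) '' I ⊆ I := by
    rintro _ ⟨a, ha, rfl⟩
    obtain ⟨t, ht⟩ := hh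
    obtain ⟨s, hs⟩ := hg
    rw [hIdef, ← hI _ _ (isOpen_setOf_iterate_mem_cocycle_eq hT hφ hU hU j h)
      (isOpen_setOf_iterate_mem_cocycle_eq hT hφ hV hV j g) ⟨t, ht⟩ ⟨s, hs⟩
      (fun _ hr => hr.1) (fun _ hr => hr.1)] at ha
    refine ha.mono ?_
    rintro n ⟨r, ⟨hrU, hjU, hjh⟩, ⟨hnV, hnjV, hnjg⟩, hna⟩
    refine ⟨T^[j] r, hjU, ?_, ?_⟩
    · rwa [← Function.iterate_add_apply, add_comm, Function.iterate_add_apply]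
    · have e₁ := cocycle_add T φ n j r
      have e₂ := cocycle_add T φ j n r
      rw [add_comm, e₁, hjh, hnjg, hna] at e₂
      exact eq_mul_inv_of_mul_eq e₂
  have himg : (fun a => g * a * h⁻¹) '' I = I := by
    refine Set.eq_of_subset_of_ncard_le hsub ?_
    rw [Set.ncard_image_of_injective]
    intro a b hab
    simpa using hab
  rw [Set.singleton_mul, Set.mul_singleton]
  nth_rewrite 2 [← himg]
  rw [Set.image_image]
  simp

theorem HomogeneousValues.returnTranslate_eq_left (hT : Continuous T) (hφ : Continuous φ)
    (hU : IsOpen U) (hV : IsOpen V) (hI : HomogeneousValues T φ R U V) {s : ℕ} {g : K}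
    (hg : s ∈ hitTimesWith T φ g V V) (hs : s ∈ hitTimes T U U) :
    returnTranslate T φ V (frequentValues T φ R U V) s = {g} * frequentValues T φ R U V := by
  obtain ⟨h, hh⟩ := exists_mem_hitTimesWith (φ := φ) hs
  refine Subset.antisymm ?_ (Set.mul_subset_mul_right (singleton_subset_iff.2 hg))
  rintro _ ⟨g', hg', a, ha, rfl⟩
  rw [hI.singleton_mul_eq hT hφ hU hV hg hh, ← hI.singleton_mul_eq hT hφ hU hV hg' hh]
  exact Set.mul_mem_mul rfl ha

variable {F : Filter ℕ}

theorem HomogeneousValues.eventually_returnTranslate_add_eq_mul_right (hT : Continuous T)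
    (hφ : Continuous φ) (hF : IsMixingFilter T F) (hU : IsOpen U) (hV : IsOpen V)
    (nU : U.Nonempty) (nV : V.Nonempty) (hI : HomogeneousValues T φ R U V) {m : ℕ} {h : K}
    (hm : m ∈ hitTimes T V V) (hh : m ∈ hitTimesWith T φ h U U) :
    ∀ᶠ r in F, returnTranslate T φ V (frequentValues T φ R U V) (r + m) =
      returnTranslate T φ V (frequentValues T φ R U V) r * {h} := by
  obtain ⟨g, hg⟩ := exists_mem_hitTimesWith (φ := φ) hm
  have hVm := isOpen_setOf_iterate_mem_cocycle_eq hT hφ hV hV m g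
  filter_upwards [hF.tendsto_add m (hF.hitTimes_mem _ V hVm hV hg nV),
    hF.tendsto_add m (hF.hitTimes_mem U U hU hU nU nU), hF.hitTimes_mem U U hU hU nU nU]
    with r h₁ h₂ h₃
  obtain ⟨t, ⟨htV, hmV, htg⟩, hrV⟩ := h₁
  have e := cocycle_add T φ r m t
  rw [htg] at e
  rw [hI.returnTranslate_eq_left hT hφ hU hV ⟨t, htV, hrV, e⟩ h₂,
    hI.returnTranslate_eq_left hT hφ hU hV (s := r) ⟨T^[m] t, hmV, ?_, rfl⟩ h₃, mul_assoc,
    ← hI.singleton_mul_eq hT hφ hU hV hg hh, ← mul_assoc, Set.singleton_mul_singleton]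
  rwa [← Function.iterate_add_apply]

theorem HomogeneousValues.eventually_returnTranslate_add_eq_mul_left (hT : Continuous T)
    (hφ : Continuous φ) (hF : IsMixingFilter T F) (hU : IsOpen U) (hV : IsOpen V)
    (nU : U.Nonempty) (nV : V.Nonempty) (hI : HomogeneousValues T φ R U V) {n : ℕ} {g : K}
    (hg : n ∈ hitTimesWith T φ g V V) :
    ∀ᶠ s in F, returnTranslate T φ V (frequentValues T φ R U V) (s + n) =
      {g} * returnTranslate T φ V (frequentValues T φ R U V) s := by
  have hVn := isOpen_setOf_iterate_mem_cocycle_eq hT hφ hV hV n g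
  filter_upwards [hF.hitTimes_mem V _ hV hVn nV hg,
    hF.tendsto_add n (hF.hitTimes_mem U U hU hU nU nU), hF.hitTimes_mem U U hU hU nU nU]
    with s h₁ h₂ h₃
  obtain ⟨t, htV, hsV, hnV, htg⟩ := h₁
  rw [add_comm s n]
  have e := cocycle_add T φ n s t
  rw [htg] at e
  rw [mem_preimage, add_comm s n] at h₂
  rw [hI.returnTranslate_eq_left hT hφ hU hV (s := n + s) ⟨t, htV, ?_, e⟩ h₂,
    hI.returnTranslate_eq_left hT hφ hU hV (s := s) ⟨t, htV, hsV, rfl⟩ h₃, ← mul_assoc,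
    Set.singleton_mul_singleton]
  rwa [Function.iterate_add_apply]

/-- Values of returns at times divisible by the order of the group stabilise the set of frequent
values. -/
theorem HomogeneousValues.singleton_mul_eq_self (hT : Continuous T) (hφ : Continuous φ)
    (hF : IsMixingFilter T F) (hU : IsOpen U) (hV : IsOpen V) (nU : U.Nonempty)
    (nV : V.Nonempty) (hI : HomogeneousValues T φ R U V) {j : ℕ} {g : K}
    (hg : Nat.card K * j ∈ hitTimesWith T φ g V V) :
    {g} * frequentValues T φ R U V = frequentValues T φ R U V := by
  have := hF.neBot
  have hDU : ∀ᶠ n in F, n ∈ hitTimes T U U := hF.hitTimes_mem U U hU hU nU nU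
  have hDV : ∀ᶠ n in F, n ∈ hitTimes T V V := hF.hitTimes_mem V V hV hV nV nV
  obtain ⟨m, hmU, hmV, hmjU, hmjV⟩ := (hDU.and (hDV.and
    (((hF.tendsto_add j).eventually hDU).and ((hF.tendsto_add j).eventually hDV)))).exists
  obtain ⟨h, hh⟩ := exists_mem_hitTimesWith (φ := φ) hmU
  obtain ⟨h', hh'⟩ := exists_mem_hitTimesWith (φ := φ) hmjU
  set I := frequentValues T φ R U V with hIdef
  let S := returnTranslate T φ V I
  have hstep : ∀ᶠ r in F, S (r + (m + j)) = S (r + m) * {h⁻¹ * h'} := by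
    filter_upwards [
      hI.eventually_returnTranslate_add_eq_mul_right hT hφ hF hU hV nU nV hmV hh,
      hI.eventually_returnTranslate_add_eq_mul_right hT hφ hF hU hV nU nV hmjV hh']
      with r h₁ h₂
    simp only [S, hIdef]
    rw [h₁, h₂, mul_assoc, Set.singleton_mul_singleton, mul_inv_cancel_left]
  have hsteps : ∀ᶠ r in F, ∀ i ∈ Set.Iio (Nat.card K),
      S (r + i * j + (m + j)) = S (r + i * j + m) * {h⁻¹ * h'} :=
    (Filter.eventually_all_finite (Set.finite_Iio _)).2 fun i _ =>
      (hF.tendsto_add (i * j)).eventually hstep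
  obtain ⟨r, hr, hrg, hrU, hrV⟩ := (hsteps.and (((hF.tendsto_add m).eventually
    (hI.eventually_returnTranslate_add_eq_mul_left hT hφ hF hU hV nU nV hg)).and
    (((hF.tendsto_add m).eventually hDU).and ((hF.tendsto_add m).eventually hDV)))).exists
  have hiter : ∀ i ≤ Nat.card K, S (r + i * j + m) = S (r + m) * {(h⁻¹ * h') ^ i} := by
    intro i
    induction i with
    | zero => simp
    | succ i ih =>
      intro hi
      have e : r + (i + 1) * j + m = r + i * j + (m + j) := by ring
      rw [e, hr i hi, ih (by omega), mul_assoc, Set.singleton_mul_singleton, pow_succ]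
  have hper := hiter _ le_rfl
  rw [pow_card_eq_one', Set.singleton_one, mul_one, add_right_comm] at hper
  replace hper : {g} * S (r + m) = S (r + m) := hrg.symm.trans hper
  obtain ⟨g₁, hg₁⟩ := exists_mem_hitTimesWith (φ := φ) hrV
  obtain ⟨h₁, hh₁⟩ := exists_mem_hitTimesWith (φ := φ) hrU
  have hS : S (r + m) = I * {h₁} := by
    rw [← hI.singleton_mul_eq hT hφ hU hV hg₁ hh₁]
    exact hI.returnTranslate_eq_left hT hφ hU hV hg₁ hrU
  have hfin : {g} * (I * {h₁}) * {h₁⁻¹} = I * {h₁} * {h₁⁻¹} := by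
    rw [← hS]
    exact congrArg (· * {h₁⁻¹}) hper
  simpa only [mul_assoc, Set.singleton_mul_singleton, mul_inv_cancel, Set.singleton_one,
    mul_one] using hfin

end ReturnValues

/-- In a finite group extension of a minimal weakly mixing map, points close to `x` can be
perturbed so as to return near `x` simultaneously with `x`, both with trivial cocycle value. -/
theorem exists_simultaneous_return {X K : Type*} [TopologicalSpace X] [CompactSpace X]
    [T2Space X] [Group K] [Finite K] [TopologicalSpace K] [DiscreteTopology K]
    {T : X → X} {φ : X → K} (hT : Continuous T) (hTs : Function.Surjective T)
    (hφ : Continuous φ) (hmin : MinimalSystem T) {F : Filter ℕ} (hF : IsMixingFilter T F)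
    (x : X) :
    ∃ V₀ : Set X, IsOpen V₀ ∧ x ∈ V₀ ∧ ∀ V ⊆ V₀, IsOpen V → V.Nonempty →
      ∀ O : Set X, IsOpen O → x ∈ O → ∀ N : ℕ, ∃ n ≥ N, ∃ y ∈ V,
        T^[n] x ∈ O ∧ T^[n] y ∈ O ∧ cocycle T φ n x = 1 ∧ cocycle T φ n y = 1 := by
  have hmink : ∀ k, 0 < k → MinimalSystem T^[k] := fun k hk => hmin.iterate hT hTs hF hk
  have hc := continuous_skewMap hT hφ
  obtain ⟨k, hk, hstable⟩ := exists_orbitClosure_iterate_stable hT hφ hmink x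
  set C := orbitClosure (skewMap T φ)^[k] (x, (1 : K)) with hCdef
  have hCopen : IsOpen C := by
    rw [hCdef, skewMap_iterate]
    exact isOpen_orbitClosure_skewMap (hT.iterate k) (continuous_cocycle hT hφ k) (hmink k hk) _
  have hCmaps : MapsTo (skewMap T φ)^[k] C C := mapsTo_orbitClosure (hc.iterate k) _
  have hCmin : ∀ j, 0 < j → ∀ w ∈ C, ∀ w' ∈ C,
      w' ∈ orbitClosure (skewMap T φ)^[k * j] w := by
    intro j hj w hw w' hw'
    rw [← hstable j hj] at hw hw'
    rw [skewMap_iterate] at hw hw' ⊢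
    exact orbitClosure_subset_of_mem
      (continuous_skewMap (hT.iterate _) (continuous_cocycle hT hφ _))
      (orbitClosure_skewMap_symm (hT.iterate _) (continuous_cocycle hT hφ _)
        (hmink _ (Nat.mul_pos hk hj)) hw) hw'
  have hV₀ : IsOpen {v : X | (v, (1 : K)) ∈ C} := hCopen.preimage (by fun_prop)
  have hzC : (x, (1 : K)) ∈ C := mem_orbitClosure_self _ _
  refine ⟨_, hV₀, hzC, fun V hVs hV nV O hO hxO N => ?_⟩
  let R : Filter ℕ := (atTop ⊓ Filter.comap (fun n => (skewMap T φ)^[n] (x, (1 : K)))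
    (𝓝 (x, 1))) ⊓ 𝓟 {n | k ∣ n}
  have hRF : ∀ D ∈ F, ∃ᶠ n in R, n ∈ D := by
    intro D hD
    rw [((Filter.atTop_basis.inf ((nhds_basis_opens (x, (1 : K))).comap _)).inf_principal
      _).frequently_iff]
    rintro ⟨M, W⟩ ⟨-, hxW, hW⟩
    obtain ⟨n, hn, hnD, hnW⟩ := hF.exists_visit (hc.iterate k)
      (isClosed_orbitClosure _ _).isCompact hCmaps hW
      (fun w hw => exists_iterate_mem_of_mem_orbitClosure
        (by simpa using hCmin 1 one_pos w hw _ hzC) hW hxW) hzC hk hD M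
    rw [← Function.iterate_mul] at hnW
    exact ⟨k * n, ⟨⟨hn.trans (Nat.le_mul_of_pos_left n hk), hnW⟩, dvd_mul_right k n⟩, hnD⟩
  obtain ⟨V₁, U₁, hV₁, hU₁, nV₁, nU₁, hV₁s, hU₁s, hI⟩ :=
    exists_homogeneousValues (T := T) (φ := φ) R hV (hO.inter hV₀) nV ⟨x, hxO, hzC⟩
  have hone : (1 : K) ∈ frequentValues T φ R V₁ U₁ := by
    obtain ⟨a, ha⟩ : ∃ a, a ∈ frequentValues T φ R V₁ U₁ := by
      by_contra! hno
      simp only [frequentValues, mem_ofPred_eq, Filter.not_frequently] at hno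
      refine hRF _ (hF.hitTimes_mem V₁ U₁ hV₁ hU₁ nV₁ nU₁) ?_
      filter_upwards [Filter.eventually_all.2 hno] with n hn hn'
      obtain ⟨a, ha⟩ := exists_mem_hitTimesWith (φ := φ) hn'
      exact hn a ha
    have hkR : ∀ᶠ n in R, k ∣ n := Filter.mem_inf_of_right (Filter.mem_principal_self _)
    obtain ⟨n, ⟨v, hv, hvU, hva⟩, q, rfl⟩ := (Filter.Frequently.and_eventually ha hkR).exists
    have huC : (T^[k * q] v, a) ∈ C := by
      have h := hCmaps.iterate q (hVs (hV₁s hv))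
      rwa [← Function.iterate_mul, skewMap_iterate_apply, hva, mul_one] at h
    have hbox : IsOpen (U₁ ×ˢ {(1 : K)}) := hU₁.prod (isOpen_discrete _)
    obtain ⟨i, hi, hi'⟩ := exists_iterate_mem_of_mem_orbitClosure
      (hCmin _ (Nat.card_pos (α := K)) _ huC _ (hU₁s hvU).2) hbox ⟨hvU, rfl⟩
    rw [← Function.iterate_mul, skewMap_iterate_apply] at hi hi'
    have hval : cocycle T φ (k * Nat.card K * i) (T^[k * q] v) = a⁻¹ :=
      eq_inv_of_mul_eq_one_left hi'
    have hmem : Nat.card K * (k * i) ∈ hitTimesWith T φ a⁻¹ U₁ U₁ := by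
      rw [← mul_assoc, mul_comm (Nat.card K)]
      exact ⟨_, hvU, hi, hval⟩
    rw [← hI.singleton_mul_eq_self hT hφ hF hV₁ hU₁ nV₁ nU₁ hmem]
    exact ⟨a⁻¹, rfl, a, ha, inv_mul_cancel a⟩
  have hbox : IsOpen (O ×ˢ {(1 : K)}) := hO.prod (isOpen_discrete _)
  have hR : ∀ᶠ n in R, N ≤ n ∧ (skewMap T φ)^[n] (x, (1 : K)) ∈ O ×ˢ {(1 : K)} :=
    Filter.mem_inf_of_left (Filter.inter_mem
      (Filter.mem_inf_of_left (Filter.eventually_ge_atTop N))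
      (Filter.mem_inf_of_right (Filter.preimage_mem_comap (hbox.mem_nhds ⟨hxO, rfl⟩))))
  obtain ⟨n, ⟨y, hy, hyU, hy1⟩, hn, hnO, hn1⟩ :=
    (Filter.Frequently.and_eventually hone hR).exists
  rw [skewMap_iterate_apply] at hnO hn1
  exact ⟨n, hn, y, hV₁s hy, hnO, (hU₁s hyU).1, by simpa using hn1, hy1⟩

/-! ### Li–Yorke pairs -/

theorem orbLiminf_eq_zero {X : Type*} [MetricSpace X] [CompactSpace X] {T : X → X} {x y : X}
    (h : ∀ δ > 0, ∃ᶠ n in atTop, dist (T^[n] x) (T^[n] y) ≤ δ) : orbLiminf T x y = 0 := by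
  have hbdd : IsBoundedUnder (· ≥ ·) atTop fun n : ℕ => dist (T^[n] x) (T^[n] y) :=
    isBoundedUnder_of ⟨0, fun _ => dist_nonneg⟩
  have hcobdd : IsCoboundedUnder (· ≥ ·) atTop fun n : ℕ => dist (T^[n] x) (T^[n] y) :=
    IsBoundedUnder.isCoboundedUnder_ge
      (isBoundedUnder_of ⟨diam univ, fun _ => dist_le_diam_of_mem isCompact_univ.isBounded
        (mem_univ _) (mem_univ _)⟩)
  refine le_antisymm (le_of_forall_pos_le_add fun δ hδ => ?_) ?_
  · rw [zero_add]
    exact liminf_le_of_frequently_le (h δ hδ) hbdd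
  · exact le_liminf_of_le hcobdd (Eventually.of_forall fun _ => dist_nonneg)

theorem le_orbLimsup {X : Type*} [MetricSpace X] [CompactSpace X] {T : X → X} {x y : X} {ε : ℝ}
    (h : ∃ᶠ n in atTop, ε ≤ dist (T^[n] x) (T^[n] y)) : ε ≤ orbLimsup T x y :=
  le_limsup_of_frequently_le h
    (isBoundedUnder_of ⟨diam univ, fun _ => dist_le_diam_of_mem isCompact_univ.isBounded
      (mem_univ _) (mem_univ _)⟩)

theorem exists_lt_dist_of_lt_diam {X : Type*} [PseudoMetricSpace X] {s : Set X} {ε : ℝ}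
    (hε : 0 ≤ ε) (h : ε < diam s) : ∃ p ∈ s, ∃ q ∈ s, ε < dist p q := by
  by_contra! hle
  exact h.not_ge (diam_le_of_forall_dist_le hε hle)

/-- In a minimal weakly mixing system, points of any nonempty open set separate from a given point
as much as the diameter allows. -/
theorem exists_separation {X : Type*} [MetricSpace X] [CompactSpace X] {T : X → X}
    (hT : Continuous T) (hmin : MinimalSystem T) {F : Filter ℕ} (hF : IsMixingFilter T F) {ε : ℝ}
    (hε : 0 ≤ ε) (hεd : ε < diam (univ : Set X)) (x : X) {V : Set X} (hV : IsOpen V)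
    (nV : V.Nonempty) (N : ℕ) : ∃ n ≥ N, ∃ y ∈ V, ε < dist (T^[n] x) (T^[n] y) := by
  obtain ⟨p, -, q, -, hpq⟩ := exists_lt_dist_of_lt_diam hε hεd
  have hopen : IsOpen {w : X × X | ε < dist w.1 w.2} := isOpen_lt continuous_const continuous_dist
  obtain ⟨O, O', hO, hO', hp, hq, hsub⟩ := isOpen_prod_iff.1 hopen p q hpq
  obtain ⟨n, hn, hnD, hnO⟩ := hF.exists_visit hT isCompact_univ (mapsTo_univ T univ) hO
    (fun w _ => exists_iterate_mem_of_mem_orbitClosure (hmin w p) hO hp) (mem_univ x) one_pos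
    (hF.hitTimes_mem V O' hV hO' nV ⟨q, hq⟩) N
  rw [one_mul] at hnD
  obtain ⟨y, hy, hyO⟩ := hnD
  exact ⟨n, hn, y, hy, hsub (mk_mem_prod hnO hyO)⟩

/-- Near every point `x` there are points that separate from `x` infinitely often and come back
to `x` infinitely often with the same cocycle value. -/
theorem mem_closure_proximal_separated {X K : Type*} [MetricSpace X] [CompactSpace X] [Group K]
    [Finite K] [TopologicalSpace K] [DiscreteTopology K] {T : X → X} {φ : X → K}
    (hT : Continuous T) (hTs : Function.Surjective T) (hφ : Continuous φ)
    (hmin : MinimalSystem T) {F : Filter ℕ} (hF : IsMixingFilter T F) {ε : ℝ} (hε : 0 ≤ ε)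
    (hεd : ε < diam (univ : Set X)) (x : X) :
    x ∈ closure {y | (∀ δ > 0, ∃ᶠ n in atTop, dist (T^[n] x) (T^[n] y) < δ ∧
      cocycle T φ n x = cocycle T φ n y) ∧ ∃ᶠ n in atTop, ε < dist (T^[n] x) (T^[n] y)} := by
  obtain ⟨V₀, hV₀, hxV₀, hret⟩ := exists_simultaneous_return hT hTs hφ hmin hF x
  let P : ℕ → Set X := fun N => ⋃ n ≥ N, {y | dist (T^[n] x) (T^[n] y) < 1 / ((N : ℝ) + 1) ∧
    cocycle T φ n x = cocycle T φ n y}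
  let Q : ℕ → Set X := fun N => ⋃ n ≥ N, {y | ε < dist (T^[n] x) (T^[n] y)}
  have hdist : ∀ n, Continuous fun y => dist (T^[n] x) (T^[n] y) :=
    fun n => continuous_const.dist (hT.iterate n)
  have hP : ∀ N, IsOpen (P N) := fun N => isOpen_biUnion fun n _ =>
    (isOpen_lt (hdist n) continuous_const).inter
      ((isOpen_discrete {g | cocycle T φ n x = g}).preimage (continuous_cocycle hT hφ n))
  have hQ : ∀ N, IsOpen (Q N) := fun N => isOpen_biUnion fun n _ =>
    isOpen_lt continuous_const (hdist n)
  have hPd : ∀ N, Dense (P N ∪ (closure V₀)ᶜ) := by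
    intro N
    rw [dense_iff_inter_open]
    intro W hW nW
    by_cases hWV : (W ∩ V₀).Nonempty
    · have hpos : (0 : ℝ) < 1 / (N + 1) / 2 := by positivity
      obtain ⟨n, hn, y, hy, h₁, h₂, h₃, h₄⟩ := hret (W ∩ V₀) inter_subset_right (hW.inter hV₀) hWV
        (ball x (1 / ((N : ℝ) + 1) / 2)) isOpen_ball (mem_ball_self hpos) N
      refine ⟨y, hy.1, Or.inl (mem_biUnion hn ⟨?_, h₃.trans h₄.symm⟩)⟩
      have := dist_triangle_right (T^[n] x) (T^[n] y) x
      rw [mem_ball] at h₁ h₂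
      linarith
    · obtain ⟨y, hy⟩ := nW
      exact ⟨y, hy, Or.inr fun hcl => hWV (_root_.mem_closure_iff.1 hcl W hW hy)⟩
  have hQd : ∀ N, Dense (Q N) := by
    intro N
    rw [dense_iff_inter_open]
    intro W hW nW
    obtain ⟨n, hn, y, hy, hd⟩ := exists_separation hT hmin hF hε hεd x hW nW N
    exact ⟨y, hy, mem_biUnion hn hd⟩
  have hdense : Dense (⋂ N, (P N ∪ (closure V₀)ᶜ) ∩ Q N) :=
    dense_iInter_of_isOpen
      (fun N => ((hP N).union isClosed_closure.isOpen_compl).inter (hQ N))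
      (fun N => (hPd N).inter_of_isOpen_right (hQd N) (hQ N))
  rw [_root_.mem_closure_iff]
  intro W hW hxW
  obtain ⟨y, ⟨hyW, hyV⟩, hy⟩ := hdense.inter_open_nonempty _ (hW.inter hV₀) ⟨x, hxW, hxV₀⟩
  rw [mem_iInter] at hy
  refine ⟨y, hyW, fun δ hδ => ?_, ?_⟩
  · rw [frequently_atTop]
    intro M
    obtain ⟨L, hL⟩ := exists_nat_one_div_lt hδ
    obtain ⟨n, hn, hd, hc⟩ := mem_iUnion₂.1
      ((hy (max M L)).1.resolve_right fun h => h (subset_closure hyV))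
    refine ⟨n, (le_max_left M L).trans hn, hd.trans_le (le_trans ?_ hL.le), hc⟩
    exact one_div_le_one_div_of_le (by positivity) (by gcongr; exact le_max_right M L)
  · rw [frequently_atTop]
    intro M
    obtain ⟨n, hn, hd⟩ := mem_iUnion₂.1 (hy M).2
    exact ⟨n, hn, hd⟩

/-- Theorem: if `(X,T)` is minimal weakly mixing, `A` a finite discrete space,
`Y = X × A` with the max-metric (the product metric), and `S(t,a) = (T t, G_t a)` a
skew-product extension with each fibre map `G_t` a bijection of `A`, then `(Y,S)` is
`LYS_ε` for every `0 < ε < diam X`. -/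
theorem stmt9 {X A : Type*} [MetricSpace X] [CompactSpace X]
    [MetricSpace A] [DiscreteTopology A] [Fintype A]
    (T : X → X) (hTc : Continuous T) (hTs : Function.Surjective T)
    (hmin : MinimalSystem T) (hwm : WeaklyMixing T)
    (G : X → A → A) (hGbij : ∀ t : X, Function.Bijective (G t))
    (S : X × A → X × A) (hSc : Continuous S)
    (hSdef : ∀ (t : X) (a : A), S (t, a) = (T t, G t a))
    (ε : ℝ) (hε : 0 < ε) (hεd : ε < Metric.diam (Set.univ : Set X)) :
    LYSeps S ε := by
  intro ⟨x, a⟩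
  have : Nonempty X := ⟨x⟩
  obtain ⟨F, hF⟩ := hwm.exists_isMixingFilter hTc hTs
  obtain ⟨ε', hεε', hε'd⟩ := exists_between hεd
  let φ : X → Equiv.Perm A := fun t => Equiv.ofBijective (G t) (hGbij t)
  let : TopologicalSpace (Equiv.Perm A) := ⊥
  have : DiscreteTopology (Equiv.Perm A) := ⟨rfl⟩
  have hφ : Continuous φ := by
    refine IsLocallyConstant.continuous ((IsLocallyConstant.iff_eventually_eq φ).2 fun t => ?_)
    have hG : ∀ b, ∀ᶠ s in 𝓝 t, G s b = G t b := by
      intro b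
      have hc : Continuous fun s => G s b := by
        have h : Continuous fun s => (S (s, b)).2 := by fun_prop
        simpa only [hSdef] using h
      exact hc.continuousAt.eventually ((isOpen_discrete {G t b}).mem_nhds rfl)
    filter_upwards [eventually_all.2 hG] with s hs
    exact Equiv.ext hs
  have hS : ∀ (n : ℕ) (t : X) (b : A), S^[n] (t, b) = (T^[n] t, cocycle T φ n t b) := by
    intro n
    induction n with
    | zero => intro t b; rfl
    | succ n ih =>
      intro t b
      rw [Function.iterate_succ_apply, hSdef, ih]
      rfl
  have hx := mem_closure_proximal_separated hTc hTs hφ hmin hF (hε.trans hεε').le hε'd x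
  refine map_mem_closure (f := fun y : X => (y, a)) (by fun_prop) hx ?_
  rintro y ⟨hprox, hsep⟩
  refine ⟨orbLiminf_eq_zero fun δ hδ => (hprox δ hδ).mono fun n hn => ?_,
    hεε'.trans_le (le_orbLimsup (hsep.mono fun n hn => ?_))⟩
  · rw [hS, hS, hn.2, Prod.dist_eq, dist_self]
    exact max_le hn.1.le hδ.le
  · rw [hS, hS, Prod.dist_eq]
    exact hn.le.trans (le_max_left _ _)
end

section
/- Let X be a compact metric space, Y a Cantor-type set, and S: X×Y → X×Y a skew-product map S(x,y) = (T(x), R_x(y)) such that for every x ∈ X the fibre map R_x is an odometer or the identity. Then for every δ > 0 there is an integer m > 0 such that for every x ∈ X, every y ∈ Y and every k ∈ ℕ, dist(y, R_x^{km}(y)) < δ. -/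
open Filter Topology Metric Set

open Classical in
/-- Addition of `1 = 1000⋯` with carry to the right on `∏ j, {0,…,p j − 1}`:
the `j`-th coordinate is increased (mod `p j`) exactly when all previous
coordinates are at their maximal value, i.e. when the carry propagates to `j`. -/
noncomputable def odometerAdd (p : ℕ → ℕ) (hp : ∀ j, 1 < p j) (x : ∀ j, Fin (p j)) :
    ∀ j, Fin (p j) := fun j =>
  if ∀ i < j, (x i : ℕ) + 1 = p i then
    ⟨((x j : ℕ) + 1) % p j, Nat.mod_lt _ (Nat.lt_trans Nat.zero_lt_one (hp j))⟩
  else x j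

/-- `R` is an odometer (adding machine): up to homeomorphism it is the map
"add `1000⋯` with carry" on a product `∏_{j≥1} {0,1,…,p_j−1}` for some sequence of
primes `p`. -/
def IsOdometer {Y : Type*} [TopologicalSpace Y] (R : Y → Y) : Prop :=
  ∃ (p : ℕ → ℕ) (hp : ∀ j, Nat.Prime (p j)) (e : Y ≃ₜ ∀ j, Fin (p j)),
    ∀ y, e (R y) = odometerAdd p (fun j => (hp j).one_lt) (e y)

/-- One step of the odometer preserves and reflects agreement of the first `n` coordinates. -/
theorem odometerAdd_agree_iff (p : ℕ → ℕ) (hp : ∀ j, 1 < p j) (n : ℕ)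
    (x y : ∀ j, Fin (p j)) :
    (∀ j < n, odometerAdd p hp x j = odometerAdd p hp y j) ↔ ∀ j < n, x j = y j := by
  constructor
  · intro h j
    induction j using Nat.strong_induction_on with
    | _ j ih =>
      intro hj
      have hprev : ∀ i < j, x i = y i := fun i hi => ih i hi (hi.trans hj)
      have hcarry : (∀ i < j, (x i : ℕ) + 1 = p i) ↔ ∀ i < j, (y i : ℕ) + 1 = p i :=
        forall₂_congr fun i hi => by rw [hprev i hi]
      have hstep := h j hj
      unfold odometerAdd at hstep
      by_cases hc : ∀ i < j, (x i : ℕ) + 1 = p i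
      · rw [if_pos hc, if_pos (hcarry.1 hc), Fin.mk.injEq] at hstep
        have hmod : (x j : ℕ) ≡ y j [MOD p j] := Nat.ModEq.add_right_cancel' 1 hstep
        exact Fin.ext (hmod.eq_of_lt_of_lt (x j).isLt (y j).isLt)
      · rwa [if_neg hc, if_neg (fun h' => hc (hcarry.2 h'))] at hstep
  · intro h j hj
    have hcarry : (∀ i < j, (x i : ℕ) + 1 = p i) ↔ ∀ i < j, (y i : ℕ) + 1 = p i :=
      forall₂_congr fun i hi => by rw [h i (hi.trans hj)]
    unfold odometerAdd
    simp only [hcarry, h j hj]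

/-- A self-map compatible, in both directions, with the fibres of a surjection onto a finite
type descends to a map of finite order. -/
theorem exists_semiconj_iterate_eq_id {Y F : Type*} [Finite F] {R : Y → Y} {c : Y → F}
    (hc : Function.Surjective c) (hR : ∀ y z, c (R y) = c (R z) ↔ c y = c z) :
    ∃ (σ : F → F) (m : ℕ), 0 < m ∧ σ^[m] = id ∧ Function.Semiconj c R σ := by
  let σ : F → F := fun f => c (R (Function.surjInv hc f))
  have hinj : Function.Injective σ := fun f g hfg => by
    simpa [Function.surjInv_eq] using (hR _ _).1 hfg
  let τ : Equiv.Perm F := Equiv.ofBijective σ (Finite.injective_iff_bijective.1 hinj)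
  refine ⟨σ, orderOf τ, orderOf_pos τ, ?_, fun y => ?_⟩
  · have h := congrArg (fun e : Equiv.Perm F => (e : F → F)) (pow_orderOf_eq_one τ)
    rwa [Equiv.Perm.coe_pow, Equiv.Perm.coe_one] at h
  · exact (hR _ _).2 (Function.surjInv_eq hc (c y)).symm

/-- In a compact metric space homeomorphic to a product, points agreeing in sufficiently many
coordinates are uniformly close. -/
theorem exists_dist_lt_of_agree {Y : Type*} [MetricSpace Y] [CompactSpace Y] {p : ℕ → ℕ}
    (e : Y ≃ₜ ∀ j, Fin (p j)) {δ : ℝ} (hδ : 0 < δ) :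
    ∃ n : ℕ, ∀ y z, (∀ j < n, e y j = e z j) → dist y z < δ := by
  let K : ℕ → Set (Y × Y) := fun n => {q | (∀ j < n, e q.1 j = e q.2 j) ∧ δ ≤ dist q.1 q.2}
  have hclosed : ∀ n, IsClosed (K n) := fun n => by
    have hK : K n = (⋂ j < n, {q : Y × Y | e q.1 j = e q.2 j}) ∩ {q | δ ≤ dist q.1 q.2} := by
      ext q
      simp [K]
    rw [hK]
    refine (isClosed_biInter fun j _ => isClosed_eq ?_ ?_).inter
      (isClosed_le continuous_const continuous_dist)
    · exact (continuous_apply j).comp (e.continuous.comp continuous_fst)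
    · exact (continuous_apply j).comp (e.continuous.comp continuous_snd)
  have hanti : Antitone K := fun a b hab q hq => ⟨fun j hj => hq.1 j (hj.trans_le hab), hq.2⟩
  have hempty : (Set.univ : Set (Y × Y)) ∩ ⋂ n, K n = ∅ := by
    refine Set.eq_empty_of_forall_notMem fun q hq => ?_
    have hq' := Set.mem_iInter.1 hq.2
    have heq : q.1 = q.2 := e.injective (funext fun j => (hq' (j + 1)).1 j j.lt_succ_self)
    have hdist := (hq' 0).2
    rw [heq, dist_self] at hdist
    exact absurd hδ hdist.not_gt
  obtain ⟨n, hn⟩ := isCompact_univ.elim_directed_family_closed K hclosed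
    hempty (directed_of_isDirected_le hanti)
  refine ⟨n, fun y z hyz => ?_⟩
  by_contra! hdist
  exact (hn.subset ⟨Set.mem_univ _, hyz, hdist⟩ : (y, z) ∈ (∅ : Set (Y × Y)))

/-- An odometer has finite cyclic factors with arbitrarily small fibres. -/
theorem IsOdometer.exists_finite_factor {Y : Type*} [MetricSpace Y] [CompactSpace Y] {R : Y → Y}
    (hR : IsOdometer R) {δ : ℝ} (hδ : 0 < δ) :
    ∃ (N : ℕ) (c : Y → Fin N) (σ : Fin N → Fin N) (m : ℕ), Continuous c ∧
      (∀ y z, c y = c z → dist y z < δ) ∧ 0 < m ∧ σ^[m] = id ∧ Function.Semiconj c R σ := by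
  obtain ⟨p, hp, e, he⟩ := hR
  obtain ⟨n, hn⟩ := exists_dist_lt_of_agree e hδ
  let ι := Fintype.equivFin (∀ j : Fin n, Fin (p j))
  let c : Y → Fin _ := fun y => ι fun j => e y j
  have hc_iff : ∀ y z, c y = c z ↔ ∀ j < n, e y j = e z j := fun y z => by
    simp only [c, ι.apply_eq_iff_eq, funext_iff, Fin.forall_iff]
  have hcont : Continuous c := (continuous_of_discreteTopology (f := ι)).comp
    (continuous_pi fun j => (continuous_apply (j : ℕ)).comp e.continuous)
  have hsurj : Function.Surjective c := by
    refine ι.surjective.comp fun f => ⟨e.symm fun j =>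
      if h : j < n then f ⟨j, h⟩ else ⟨0, (hp j).pos⟩, ?_⟩
    funext j
    simp
  obtain ⟨σ, m, hm, hσ, hsemi⟩ := exists_semiconj_iterate_eq_id (R := R) hsurj fun y z => by
    rw [hc_iff, hc_iff, he, he]
    exact odometerAdd_agree_iff p _ n _ _
  exact ⟨_, c, σ, m, hcont, fun y z h => hn y z ((hc_iff y z).1 h), hm, hσ, hsemi⟩

/-- In a continuous family of self-maps of a compact space, being semiconjugate to a given
self-map of a discrete space through a given continuous map is an open condition. -/
theorem eventually_semiconj {X Y F : Type*} [TopologicalSpace X] [TopologicalSpace Y]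
    [CompactSpace Y] [TopologicalSpace F] [DiscreteTopology F] {R : X → Y → Y}
    (hR : Continuous fun q : X × Y => R q.1 q.2) {c : Y → F} (hc : Continuous c) {σ : F → F}
    {x₀ : X} (h : Function.Semiconj c (R x₀) σ) :
    ∀ᶠ x in 𝓝 x₀, Function.Semiconj c (R x) σ := by
  have hpair : Continuous fun q : X × Y => (c (R q.1 q.2), σ (c q.2)) :=
    (hc.comp hR).prodMk (continuous_of_discreteTopology.comp (hc.comp continuous_snd))
  have hopen : IsOpen {q : X × Y | c (R q.1 q.2) = σ (c q.2)} :=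
    (isOpen_discrete {f : F × F | f.1 = f.2}).preimage hpair
  have := isCompact_univ.eventually_forall_of_forall_eventually (x₀ := x₀) (K := (univ : Set Y))
    (P := fun x y => c (R x y) = σ (c y)) fun y _ => hopen.mem_nhds (h y)
  exact this.mono fun x hx y => hx y (mem_univ y)

/-- If `Y` is a Cantor-type set and `S(x,y) = (T x, R_x y)` a skew-product on `X × Y`
whose fibre maps `R_x` are odometers or the identity then, for every `δ > 0` there is an
`m > 0` such that, for every `x ∈ X`, `y ∈ Y` and `k ∈ ℕ`, `dist y (R_x^[k*m] y) < δ`. -/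
theorem stmt12 {X Y : Type*} [MetricSpace X] [CompactSpace X]
    [MetricSpace Y] [CompactSpace Y] [TotallyDisconnectedSpace Y]
    (hperf : ∀ y : Y, (𝓝[≠] y).NeBot)
    (T : X → X) (R : X → Y → Y)
    (S : X × Y → X × Y) (hSc : Continuous S)
    (hSdef : ∀ (x : X) (y : Y), S (x, y) = (T x, R x y))
    (hR : ∀ x : X, IsOdometer (R x) ∨ R x = id)
    (δ : ℝ) (hδ : 0 < δ) :
    ∃ m : ℕ, 0 < m ∧ ∀ (x : X) (y : Y) (k : ℕ), dist y ((R x)^[k * m] y) < δ := by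
  have hRc : Continuous fun q : X × Y => R q.1 q.2 :=
    (continuous_snd.comp hSc).congr fun q => congrArg Prod.snd (hSdef q.1 q.2)
  by_cases hid : ∀ x, R x = id
  · exact ⟨1, one_pos, fun x y k => by simpa [hid x] using hδ⟩
  push Not at hid
  obtain ⟨x₁, hx₁⟩ := hid
  have hlocal : ∀ x₀, ∃ m : ℕ, 0 < m ∧
      ∀ᶠ x in 𝓝 x₀, ∀ (y : Y) (k : ℕ), dist y ((R x)^[k * m] y) < δ := by
    intro x₀
    suffices h : ∃ (N : ℕ) (c : Y → Fin N) (σ : Fin N → Fin N) (m : ℕ), Continuous c ∧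
        (∀ y z, c y = c z → dist y z < δ) ∧ 0 < m ∧ σ^[m] = id ∧
          Function.Semiconj c (R x₀) σ by
      obtain ⟨N, c, σ, m, hc, hfib, hm, hσ, hsemi⟩ := h
      refine ⟨m, hm, (eventually_semiconj hRc hc hsemi).mono fun x hx y k => hfib _ _ ?_⟩
      rw [(hx.iterate_right (k * m)).eq, mul_comm, Function.iterate_mul, hσ,
        Function.iterate_id, id]
    rcases hR x₀ with hodo | hid₀
    · exact hodo.exists_finite_factor hδ
    · obtain ⟨N, c, -, -, hc, hfib, -⟩ :=
        ((hR x₁).resolve_right hx₁).exists_finite_factor hδ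
      exact ⟨N, c, id, 1, hc, hfib, one_pos, rfl, fun y => by simp [hid₀]⟩
  choose m hm hnhds using hlocal
  obtain ⟨t, ht⟩ := CompactSpace.elim_nhds_subcover _ hnhds
  refine ⟨∏ x ∈ t, m x, Finset.prod_pos fun x _ => hm x, fun x y k => ?_⟩
  have hx : x ∈ (⊤ : Set X) := mem_univ x
  rw [← ht] at hx
  obtain ⟨x₀, hx₀, hxmem⟩ := mem_iUnion₂.1 hx
  obtain ⟨l, hl⟩ := Finset.dvd_prod_of_mem m hx₀
  rw [hl, mul_left_comm, mul_comm]
  exact hxmem y (k * l)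
end

section
/- Let (X,ρ) be a compact metric space such that every connected component of X is nowhere dense in X. Then for every δ > 0 there is a finite decomposition X = X_1 ∪ X_2 ∪ … ∪ X_m of X into pairwise disjoint compact subsets such that for every j, X_j is contained in the δ-neighborhood of some connected component of X. -/
open Filter Topology Metric Set

/-- In a compact Hausdorff space, a neighborhood of a connected component contains a clopen
neighborhood of that component. -/
theorem exists_isClopen_subset_of_connectedComponent_subset {X : Type*} [TopologicalSpace X]
    [T2Space X] [CompactSpace X] {x : X} {U : Set X} (hU : IsOpen U)
    (hxU : connectedComponent x ⊆ U) : ∃ V : Set X, IsClopen V ∧ x ∈ V ∧ V ⊆ U := by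
  have : Nonempty {s : Set X // IsClopen s ∧ x ∈ s} := ⟨⟨univ, isClopen_univ, mem_univ x⟩⟩
  obtain ⟨V, hV⟩ := exists_subset_nhds_of_compactSpace
    (V := fun s : {s : Set X // IsClopen s ∧ x ∈ s} => s.1) (U := U)
    (fun s t => ⟨⟨s.1 ∩ t.1, s.2.1.inter t.2.1, s.2.2, t.2.2⟩,
      inter_subset_left, inter_subset_right⟩)
    (fun s => s.2.1.isClosed)
    (fun y hy => hU.mem_nhds (hxU (by rwa [connectedComponent_eq_iInter_isClopen])))
  exact ⟨V.1, V.2.1, V.2.2, hV⟩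

/-- Every cover of a compact space by clopen neighborhoods of its points has a finite disjoint
clopen refinement. -/
theorem exists_disjoint_isClopen_refinement {X : Type*} [TopologicalSpace X] [CompactSpace X]
    (V : X → Set X) (hV : ∀ x, IsClopen (V x)) (hxV : ∀ x, x ∈ V x) :
    ∃ (m : ℕ) (P : Fin m → Set X), (∀ j, IsClopen (P j)) ∧
      (∀ i j, i ≠ j → Disjoint (P i) (P j)) ∧ (⋃ j, P j) = univ ∧ ∀ j, ∃ x, P j ⊆ V x := by
  obtain ⟨t, ht⟩ := CompactSpace.elim_nhds_subcover V fun x => (hV x).isOpen.mem_nhds (hxV x)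
  let f : Fin t.card → Set X := fun j => V (t.equivFin.symm j)
  refine ⟨t.card, disjointed f, fun j => ?_, fun i j hij => disjoint_disjointed f hij, ?_,
    fun j => ⟨t.equivFin.symm j, disjointed_le f j⟩⟩
  · exact disjointedRec (p := IsClopen) (fun _ _ hs => hs.diff (hV _)) (hV _)
  · have h : (⋃ j, disjointed f j) = ⋃ j, f j := iSup_disjointed f
    rw [h, eq_univ_iff_forall]
    intro y
    obtain ⟨x, hx, hy⟩ := mem_iUnion₂.mp (ht.ge (mem_univ y))
    exact mem_iUnion.mpr ⟨t.equivFin ⟨x, hx⟩, by simpa [f] using hy⟩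

/-- If every connected component of a compact metric space `X` is nowhere dense then,
for every `δ > 0`, `X` admits a finite decomposition into pairwise disjoint compact sets
each of which is contained in the `δ`-neighborhood of some connected component. -/
theorem stmt15 {X : Type*} [MetricSpace X] [CompactSpace X]
    (hnd : ∀ x : X, IsNowhereDense (connectedComponent x))
    (δ : ℝ) (hδ : 0 < δ) :
    ∃ (m : ℕ) (P : Fin m → Set X),
      (∀ j, IsCompact (P j)) ∧
      (∀ i j, i ≠ j → Disjoint (P i) (P j)) ∧
      (⋃ j, P j) = Set.univ ∧
      ∀ j, ∃ x : X, P j ⊆ {z : X | Metric.infDist z (connectedComponent x) < δ} := by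
  have h (x : X) := exists_isClopen_subset_of_connectedComponent_subset (x := x)
    (isOpen_lt (continuous_infDist_pt (connectedComponent x)) continuous_const)
    (fun z hz => (infDist_zero_of_mem hz).trans_lt hδ)
  choose V hV hxV hVU using h
  obtain ⟨m, P, hP, hd, hu, hs⟩ := exists_disjoint_isClopen_refinement V hV hxV
  exact ⟨m, P, fun j => (hP j).isClosed.isCompact, hd, hu,
    fun j => (hs j).imp fun x hx => hx.trans (hVU x)⟩
end

section
/- Let (X,T) be a Li-Yorke sensitive topological dynamical system, and let Dist denote the set of distal pairs (x,y) ∈ X×X. Assume there is a nonempty open set H ⊆ X such that (H×H) ∩ Dist has empty interior, or equivalently such that (H×H) ∩ Dist is a set of the first Baire category. Then there is ε > 0 such that (X,T) is Li-Yorke chaotic with constant ε, i.e., (X,T) has an uncountable ε-scrambled set. -/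
open Filter Topology Metric Set

/-- One half of the Kuratowski–Ulam theorem: almost all sections of a residual set are residual. -/
theorem eventually_eventually_residual_of_residual_prod {Y Z : Type*} [TopologicalSpace Y]
    [TopologicalSpace Z] [SecondCountableTopology Z] {s : Set (Y × Z)}
    (hs : s ∈ residual (Y × Z)) : ∀ᶠ x in residual Y, ∀ᶠ y in residual Z, (x, y) ∈ s := by
  obtain ⟨S, hSo, hSd, hSc, hSs⟩ := mem_residual_iff.1 hs
  have hopen : ∀ G ∈ S, ∀ᶠ x in residual Y, ∀ᶠ y in residual Z, (x, y) ∈ G := by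
    intro G hG
    have hbasis : ∀ᶠ x in residual Y, ∀ V ∈ TopologicalSpace.countableBasis Z,
        ∃ y ∈ V, (x, y) ∈ G := by
      refine (eventually_countable_ball (TopologicalSpace.countable_countableBasis Z)).2 ?_
      intro V hV
      have hVo := TopologicalSpace.isOpen_of_mem_countableBasis hV
      have hVne := TopologicalSpace.nonempty_of_mem_countableBasis hV
      have himage : {x : Y | ∃ y ∈ V, (x, y) ∈ G} = Prod.fst '' (G ∩ Prod.snd ⁻¹' V) := by
        ext x
        simp [and_comm]
      refine residual_of_dense_open (s := {x : Y | ∃ y ∈ V, (x, y) ∈ G}) ?_ ?_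
      · rw [himage]
        exact isOpenMap_fst _ ((hSo G hG).inter (hVo.preimage continuous_snd))
      · refine dense_iff_inter_open.2 fun U hU hUne => ?_
        obtain ⟨p, hp, hpG⟩ := (hSd G hG).inter_open_nonempty _ (hU.prod hVo) (hUne.prod hVne)
        exact ⟨p.1, hp.1, p.2, hp.2, hpG⟩
    filter_upwards [hbasis] with x hx
    refine residual_of_dense_open ((hSo G hG).preimage (by fun_prop : Continuous (Prod.mk x))) ?_
    refine (TopologicalSpace.isBasis_countableBasis Z).dense_iff.2 fun V hV _ => ?_
    obtain ⟨y, hyV, hyG⟩ := hx V hV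
    exact ⟨y, hyV, hyG⟩
  filter_upwards [(eventually_countable_ball hSc).2 hopen] with x hx
  filter_upwards [(eventually_countable_ball hSc).2 hx] with y hy
  exact hSs (mem_sInter.2 hy)

/-- A weak form of Mycielski's theorem: an irreflexive symmetric residual relation has an
uncountable clique. -/
theorem exists_not_countable_pairwise_of_residual {Y : Type*} [TopologicalSpace Y]
    [SecondCountableTopology Y] [BaireSpace Y] [Nonempty Y] (r : Y → Y → Prop)
    (hsymm : ∀ x y, r x y → r y x) (hirrefl : ∀ x, ¬ r x x) (hr : ∀ᶠ p in residual (Y × Y), r p.1 p.2) :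
    ∃ D : Set Y, ¬ D.Countable ∧ D.Pairwise r := by
  have hsec : ∀ᶠ x in residual Y, ∀ᶠ y in residual Y, r x y :=
    eventually_eventually_residual_of_residual_prod hr
  obtain ⟨D, hD⟩ := zorn_subset
    {D : Set Y | (∀ x ∈ D, ∀ᶠ y in residual Y, r x y) ∧ D.Pairwise r} (by
      intro c hc hchain
      refine ⟨⋃₀ c, ⟨?_, hchain.pairwise_sUnion.2 fun s hs => (hc hs).2⟩,
        fun s hs => subset_sUnion_of_mem hs⟩
      rintro x ⟨s, hs, hxs⟩
      exact (hc hs).1 x hxs)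
  refine ⟨D, fun hDc => ?_, hD.prop.2⟩
  obtain ⟨y, hy, hyD⟩ := (dense_of_mem_residual
    (hsec.and ((eventually_countable_ball hDc).2 hD.prop.1))).nonempty
  have hyn : y ∉ D := fun h => hirrefl y (hyD y h)
  refine hyn (hD.le_of_ge (y := insert y D) ⟨?_, ?_⟩ (subset_insert y D) (mem_insert y D))
  · rintro x (rfl | hx)
    exacts [hy, hD.prop.1 x hx]
  · exact hD.prop.2.insert fun x hx _ => ⟨hsymm x y (hyD x hx), hyD x hx⟩

theorem isBoundedUnder_le_dist_iterate {X : Type*} [MetricSpace X] [CompactSpace X]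
    (T : X → X) (x y : X) :
    atTop.IsBoundedUnder (· ≤ ·) fun n : ℕ => dist (T^[n] x) (T^[n] y) :=
  isBoundedUnder_of ⟨Metric.diam (univ : Set X), fun _ =>
    dist_le_diam_of_mem isCompact_univ.isBounded (mem_univ _) (mem_univ _)⟩

theorem isBoundedUnder_ge_dist_iterate {X : Type*} [MetricSpace X]
    (T : X → X) (x y : X) :
    atTop.IsBoundedUnder (· ≥ ·) fun n : ℕ => dist (T^[n] x) (T^[n] y) :=
  isBoundedUnder_of ⟨0, fun _ => dist_nonneg⟩

theorem orbLiminf_nonneg {X : Type*} [MetricSpace X] [CompactSpace X]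
    (T : X → X) (x y : X) : 0 ≤ orbLiminf T x y :=
  le_liminf_of_le (isBoundedUnder_le_dist_iterate T x y).isCoboundedUnder_ge
    (Eventually.of_forall fun _ => dist_nonneg)

theorem LiYorkePairEps.of_frequently {X : Type*} [MetricSpace X] [CompactSpace X]
    {T : X → X} {ε δ : ℝ} (hεδ : ε < δ) {x y : X}
    (hprox : ∀ k : ℕ, ∃ᶠ n in atTop, dist (T^[n] x) (T^[n] y) < 1 / ((k : ℝ) + 1))
    (hsep : ∃ᶠ n in atTop, δ < dist (T^[n] x) (T^[n] y)) : LiYorkePairEps T ε x y := by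
  refine ⟨le_antisymm (le_of_forall_pos_le_add fun η hη => ?_) (orbLiminf_nonneg T x y), ?_⟩
  · obtain ⟨k, hk⟩ := exists_nat_one_div_lt hη
    rw [zero_add]
    exact (liminf_le_of_frequently_le ((hprox k).mono fun _ => le_of_lt)
      (isBoundedUnder_ge_dist_iterate T x y)).trans hk.le
  · exact hεδ.trans_le (le_limsup_of_frequently_le (hsep.mono fun _ => le_of_lt)
      (isBoundedUnder_le_dist_iterate T x y))

theorem LiYorkePairEps.symm {X : Type*} [MetricSpace X]
    {T : X → X} {ε : ℝ} {x y : X} (h : LiYorkePairEps T ε x y) :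
    LiYorkePairEps T ε y x := by
  simpa only [LiYorkePairEps, orbLiminf, orbLimsup, dist_comm] using h

theorem not_liYorkePairEps_self {X : Type*} [MetricSpace X]
    {T : X → X} {ε : ℝ} (hε : 0 < ε) (x : X) :
    ¬ LiYorkePairEps T ε x x := by
  simp [LiYorkePairEps, orbLimsup, hε.le]

/-- If the pairs of points of `H` whose orbit distance lies in the open set `V` infinitely often
are dense in `H × H`, then they form a residual set. -/
theorem eventually_residual_frequently_dist_mem {X : Type*} [MetricSpace X]
    {T : X → X} (hT : Continuous T) (H : Set X)
    {V : Set ℝ} (hV : IsOpen V)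
    (hd : ∀ U W : Set X, IsOpen U → IsOpen W → (H ∩ U).Nonempty → (H ∩ W).Nonempty →
      ∃ x ∈ H ∩ U, ∃ y ∈ H ∩ W, ∃ᶠ n in atTop, dist (T^[n] x) (T^[n] y) ∈ V) :
    ∀ᶠ p in residual (H × H), ∃ᶠ n in atTop, dist (T^[n] (p.1 : X)) (T^[n] (p.2 : X)) ∈ V := by
  simp only [frequently_atTop]
  refine eventually_countable_forall.2 fun N => ?_
  refine residual_of_dense_open
    (s := {p : H × H | ∃ n ≥ N, dist (T^[n] (p.1 : X)) (T^[n] (p.2 : X)) ∈ V}) ?_ ?_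
  · have hunion : {p : H × H | ∃ n ≥ N, dist (T^[n] (p.1 : X)) (T^[n] (p.2 : X)) ∈ V} =
        ⋃ n ≥ N, (fun p : H × H => dist (T^[n] (p.1 : X)) (T^[n] (p.2 : X))) ⁻¹' V := by
      ext p
      simp
    rw [hunion]
    refine isOpen_biUnion fun n _ => hV.preimage ?_
    have := hT.iterate n
    fun_prop
  · refine fun p => mem_closure_iff_nhds.2 fun t ht => ?_
    obtain ⟨u, hu, w, hw, huw⟩ := mem_nhds_prod_iff.1 ht
    obtain ⟨u', hu', hu'o, hpu⟩ := _root_.mem_nhds_iff.1 hu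
    obtain ⟨w', hw', hw'o, hpw⟩ := _root_.mem_nhds_iff.1 hw
    obtain ⟨U, hU, rfl⟩ := isOpen_induced_iff.1 hu'o
    obtain ⟨W, hW, rfl⟩ := isOpen_induced_iff.1 hw'o
    obtain ⟨x, hx, y, hy, hfreq⟩ := hd U W hU hW ⟨p.1, p.1.2, hpu⟩ ⟨p.2, p.2.2, hpw⟩
    exact ⟨(⟨x, hx.1⟩, ⟨y, hy.1⟩), huw ⟨hu' hx.2, hw' hy.2⟩, frequently_atTop.1 hfreq N⟩

/-- If `(X,T)` is Li-Yorke sensitive and there is a nonempty open `H ⊆ X` such that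
`(H × H) ∩ Dist` has empty interior (equivalently, is of the first Baire category),
then `(X,T)` is `LYC_ε` for some `ε > 0`, i.e. it has an uncountable `ε`-scrambled
set. -/
theorem stmt19 {X : Type*} [MetricSpace X] [CompactSpace X]
    (T : X → X) (hTc : Continuous T) (hTs : Function.Surjective T)
    (hlys : LYS T)
    (H : Set X) (hHo : IsOpen H) (hHne : H.Nonempty)
    (hdist : interior ((H ×ˢ H) ∩ {p : X × X | orbLiminf T p.1 p.2 > 0}) = ∅) :
    ∃ ε > (0 : ℝ), ∃ D : Set X, ¬ D.Countable ∧ ScrambledSet T ε D := by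
  obtain ⟨ε, hε, hsens⟩ := hlys
  have hprox : ∀ᶠ p in residual (H × H), ∀ k : ℕ, ∃ᶠ n in atTop,
      dist (T^[n] (p.1 : X)) (T^[n] (p.2 : X)) < 1 / ((k : ℝ) + 1) := by
    refine eventually_countable_forall.2 fun k => ?_
    refine eventually_residual_frequently_dist_mem hTc H isOpen_Iio fun U W hU hW hHU hHW => ?_
    by_contra! hcon
    refine (hHU.prod hHW).ne_empty (subset_empty_iff.1 (hdist ▸ interior_maximal ?_
      ((hHo.inter hU).prod (hHo.inter hW))))
    rintro ⟨x, y⟩ ⟨hx, hy⟩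
    refine ⟨⟨hx.1, hy.1⟩, ?_⟩
    have hev := hcon x hx y hy
    exact (Nat.one_div_pos_of_nat (n := k)).trans_le
      (le_liminf_of_le (isBoundedUnder_le_dist_iterate T x y).isCoboundedUnder_ge
        (hev.mono fun _ => notMem_Iio.1))
  have hsep : ∀ᶠ p in residual (H × H), ∃ᶠ n in atTop,
      ε / 4 < dist (T^[n] (p.1 : X)) (T^[n] (p.2 : X)) := by
    refine eventually_residual_frequently_dist_mem hTc H isOpen_Ioi ?_
    rintro U W hU hW ⟨x, hx⟩ ⟨y, hy⟩
    obtain ⟨z, hzW, hz⟩ := mem_closure_iff.1 (hsens y) _ (hHo.inter hW) hy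
    have hfreq : ∃ᶠ n in atTop, ε < dist (T^[n] y) (T^[n] z) :=
      frequently_lt_of_lt_limsup (isBoundedUnder_ge_dist_iterate T y z).isCoboundedUnder_le hz.2
    have hor : ∃ᶠ n in atTop, ε / 4 < dist (T^[n] x) (T^[n] y) ∨
        ε / 4 < dist (T^[n] x) (T^[n] z) := by
      refine hfreq.mono fun n hn => ?_
      by_contra! hcon
      linarith [dist_triangle_left (T^[n] y) (T^[n] z) (T^[n] x)]
    rcases frequently_or_distrib.1 hor with h | h
    · exact ⟨x, hx, y, hy, h⟩
    · exact ⟨x, hx, z, hzW, h⟩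
  have : BaireSpace H := hHo.baireSpace
  have : Nonempty H := hHne.to_subtype
  obtain ⟨D, hDc, hD⟩ := exists_not_countable_pairwise_of_residual
    (fun x y : H => LiYorkePairEps T (ε / 8) x y) (fun _ _ h => h.symm)
    (fun x => not_liYorkePairEps_self (by positivity) (x : X))
    (by
      filter_upwards [hprox, hsep] with p hp hs
      exact LiYorkePairEps.of_frequently (by linarith) hp hs)
  refine ⟨ε / 8, by positivity, Subtype.val '' D,
    fun h => hDc (countable_of_injective_of_countable_image Subtype.val_injective.injOn h), ?_⟩
  rintro _ ⟨x, hx, rfl⟩ _ ⟨y, hy, rfl⟩ hxy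
  exact hD hx hy fun h => hxy (congrArg Subtype.val h)
end
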